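/- arXiv:2405.12104 — 2 statements merged into one kernel-verified Lean document; each statement's English description precedes it below -/
import Mathlib

section
/- For every timed automaton A, the encoding map ι_A is well defined and injective from the set Exec(A) of accepting executions of A into the set of flows f : ℝ≥0 → 𝒫(MP) over the monadic predicates MP = V ∪ T ∪ R: every ι_A(ρ) is a finitely variable map, and distinct accepting executions ρ1 ≠ ρ2 satisfy ι_A(ρ1) ≠ ι_A(ρ2). -/
namespace HyTime

/-! ### Comparisons and clock constraints -/

/-- Comparison operators `<, ≤, =, ≥, >` used in clock constraints. -/
inductive Cmp where
  | lt | le | eq | ge | gt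
  deriving DecidableEq

def Cmp.denote : Cmp → ℝ → ℝ → Prop
  | .lt => fun a b => a < b
  | .le => fun a b => a ≤ b
  | .eq => fun a b => a = b
  | .ge => fun a b => b ≤ a
  | .gt => fun a b => b < a

def Cmp.code : Cmp → ℕ
  | .lt => 0
  | .le => 1
  | .eq => 2
  | .ge => 3
  | .gt => 4

/-- Clock constraints over one clock: positive boolean combinations of atoms `x ∼ c`,
where the constants `c` come from `α` (naturals, or rationals). -/
inductive ClkC (α : Type) where
  | atom : Cmp → α → ClkC α
  | disj : ClkC α → ClkC α → ClkC α
  | conj : ClkC α → ClkC α → ClkC α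
  deriving DecidableEq

namespace ClkC
variable {α β : Type}

/-- Satisfaction of a clock constraint by a clock value `v : ℝ`;
`toR` interprets the constants as reals. -/
def holds (toR : α → ℝ) (v : ℝ) : ClkC α → Prop
  | .atom c k => c.denote v (toR k)
  | .disj a b => a.holds toR v ∨ b.holds toR v
  | .conj a b => a.holds toR v ∧ b.holds toR v

/-- A missing constraint (`none`) is the trivial constraint. -/
def holdsOpt (toR : α → ℝ) (v : ℝ) : Option (ClkC α) → Prop
  | none => True
  | some c => c.holds toR v

def map (f : α → β) : ClkC α → ClkC β
  | .atom c k => .atom c (f k)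
  | .disj a b => .disj (a.map f) (b.map f)
  | .conj a b => .conj (a.map f) (b.map f)

/-- The list of constants appearing in a clock constraint. -/
def consts : ClkC α → List α
  | .atom _ k => [k]
  | .disj a b => a.consts ++ b.consts
  | .conj a b => a.consts ++ b.consts

end ClkC

/-- The canonical interpretation of natural-number constants as reals. -/
def natR : ℕ → ℝ := fun n => (n : ℝ)

/-- The canonical interpretation of rational constants as reals. -/
def ratR : ℚ → ℝ := fun q => (q : ℝ)

/-! ### Intervals of reals -/

/-- A bounded real interval, with open/closed information at both endpoints. -/
structure TIvl where
  lo : ℝ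
  hi : ℝ
  loC : Bool
  hiC : Bool
  deriving Inhabited

namespace TIvl

/-- Membership of a time point in an interval. -/
def Mem (t : ℝ) (I : TIvl) : Prop :=
  (if I.loC then I.lo ≤ t else I.lo < t) ∧ (if I.hiC then t ≤ I.hi else t < I.hi)

/-- A well-formed (nonempty) interval: either nondegenerate, or a closed singular interval. -/
def WF (I : TIvl) : Prop :=
  I.lo < I.hi ∨ (I.lo = I.hi ∧ I.loC = true ∧ I.hiC = true)

/-- Two intervals are consecutive: they share the endpoint `R(I) = L(J)`,
which belongs to exactly one of them (hence they are disjoint). -/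
def Consecutive (I J : TIvl) : Prop := I.hi = J.lo ∧ I.hiC = !J.loC

end TIvl

/-! ### Timed automata (interval-based) -/

/-- An edge of an interval-based timed automaton:
source, destination, guard (a set of constraints, each over a designated clock), reset set. -/
abbrev IEdge (α : Type) := ℕ × ℕ × List (ℕ × ClkC α) × List ℕ

/-- A timed automaton `A = (V, V₀, α, X, β, E, V_F)` over atomic propositions `props`.
States, propositions and clocks are natural numbers; all components are finite (lists).
`label` is the state labeling, `beta` assigns to (state, clock) pairs a clock constraint. -/
structure TA (α : Type) where
  states : List ℕ
  init : List ℕ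
  props : List ℕ
  clocks : List ℕ
  label : List (ℕ × List ℕ)
  beta : List ((ℕ × ℕ) × ClkC α)
  edges : List (IEdge α)
  final : List ℕ

namespace TA
variable {α β : Type}

def labelOf (A : TA α) (v : ℕ) : List ℕ := (A.label.lookup v).getD []

def betaOf (A : TA α) (v x : ℕ) : Option (ClkC α) :=
  (A.beta.find? (fun q => q.1.1 == v && q.1.2 == x)).map (·.2)

/-- All constants appearing in the constraints of a timed automaton. -/
def consts (A : TA α) : List α :=
  (A.beta.map (·.2)).flatMap ClkC.consts ++
    A.edges.flatMap (fun e => (e.2.2.1.map (·.2)).flatMap ClkC.consts)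

/-- Apply a function to every constant of the automaton. -/
def map (f : α → β) (A : TA α) : TA β where
  states := A.states
  init := A.init
  props := A.props
  clocks := A.clocks
  label := A.label
  beta := A.beta.map (fun q => (q.1, q.2.map f))
  edges := A.edges.map (fun e => (e.1, e.2.1, e.2.2.1.map (fun p => (p.1, p.2.map f)), e.2.2.2))
  final := A.final

end TA

/-! ### Executions of timed automata -/

/-- The raw data of an execution `(v₁,I₁) →^{γ₁}_{Ψ₁} ⋯ →^{γ_{n-1}}_{Ψ_{n-1}} (vₙ,Iₙ)`. -/
structure RawExec (α : Type) where
  states : List ℕ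
  ivls : List TIvl
  guards : List (List (ℕ × ClkC α))
  resets : List (List ℕ)
  deriving Inhabited

namespace RawExec
variable {α : Type}

def n (ρ : RawExec α) : ℕ := ρ.states.length
def ivl (ρ : RawExec α) (i : ℕ) : TIvl := ρ.ivls.getD i default
def state (ρ : RawExec α) (i : ℕ) : ℕ := ρ.states.getD i 0
def reset (ρ : RawExec α) (i : ℕ) : List ℕ := ρ.resets.getD i []
def guard (ρ : RawExec α) (i : ℕ) : List (ℕ × ClkC α) := ρ.guards.getD i []

/-- The `i`-th edge taken by the execution. -/
def edge (ρ : RawExec α) (i : ℕ) : IEdge α := (ρ.state i, ρ.state (i+1), ρ.guard i, ρ.reset i)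

/-- The clock valuation `μ_{i+1}` when entering the `(i+1)`-st state: clocks start at `0`,
advance with elapsed time, and the clocks reset at a transition are set to `0`. -/
def mu (ρ : RawExec α) : ℕ → ℕ → ℝ
  | 0, _ => 0
  | i+1, x => if x ∈ ρ.reset i then 0 else ρ.mu i x + ((ρ.ivl i).hi - (ρ.ivl i).lo)

/-- `t ∈ len(ρ)`. -/
def MemLen (t : ℝ) (ρ : RawExec α) : Prop := ∃ i, i < ρ.n ∧ TIvl.Mem t (ρ.ivl i)

/-- `ρ(t) = v`: at time `t` the execution is at state `v`. -/
def StateAt (ρ : RawExec α) (t : ℝ) (v : ℕ) : Prop :=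
  ∃ i, i < ρ.n ∧ TIvl.Mem t (ρ.ivl i) ∧ ρ.state i = v

/-- `ρ` is an execution of `A`: consistent lengths, an interval sequence starting at `0`,
an initial state, edges of `A`, state constraints throughout each interval, and
guard constraints at the transition times. -/
def IsExec (toR : α → ℝ) (A : TA α) (ρ : RawExec α) : Prop :=
  0 < ρ.n ∧ ρ.ivls.length = ρ.n ∧ ρ.guards.length = ρ.n - 1 ∧ ρ.resets.length = ρ.n - 1 ∧
  (ρ.ivl 0).lo = 0 ∧ (ρ.ivl 0).loC = true ∧
  (∀ i, i < ρ.n → (ρ.ivl i).WF) ∧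
  (∀ i, i + 1 < ρ.n → (ρ.ivl i).Consecutive (ρ.ivl (i+1))) ∧
  ρ.state 0 ∈ A.init ∧
  (∀ i, i + 1 < ρ.n → ρ.edge i ∈ A.edges) ∧
  (∀ i, i < ρ.n → ∀ x ∈ A.clocks, ∀ t : ℝ, TIvl.Mem t (ρ.ivl i) →
    ClkC.holdsOpt toR (ρ.mu i x + t - (ρ.ivl i).lo) (A.betaOf (ρ.state i) x)) ∧
  (∀ i, i + 1 < ρ.n → ∀ q ∈ ρ.guard i,
    ClkC.holds toR (ρ.mu i q.1 + (ρ.ivl i).hi - (ρ.ivl i).lo) q.2)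

/-- An accepting execution: ends in a final state. -/
def IsAccExec (toR : α → ℝ) (A : TA α) (ρ : RawExec α) : Prop :=
  ρ.IsExec toR A ∧ ρ.state (ρ.n - 1) ∈ A.final

/-- The execution is bounded by `N`: no time point `≥ N` belongs to it. -/
def BoundedBy (ρ : RawExec α) (N : ℝ) : Prop := ∀ t : ℝ, N ≤ t → ¬ MemLen t ρ

/-- Membership in `Exec(A)` (if `bd = none`) resp. `Exec_N(A)` (if `bd = some N`). -/
def InSem (toR : α → ℝ) (A : TA α) (bd : Option ℝ) (ρ : RawExec α) : Prop :=
  ρ.IsAccExec toR A ∧ ∀ N, bd = some N → ρ.BoundedBy N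

/-- Index of the interval containing `t`. -/
noncomputable def idxAt (ρ : RawExec α) (t : ℝ) : ℕ :=
  ρ.ivls.findIdx (fun I => @decide (TIvl.Mem t I) (Classical.propDecidable _))

/-- The prefix `ρ|_t` of an execution up to time `t`:
the last interval is intersected with `[0, t]`. -/
noncomputable def prefixUpTo (ρ : RawExec α) (t : ℝ) : RawExec α :=
  let i := ρ.idxAt t
  ⟨ρ.states.take (i + 1),
   ρ.ivls.take i ++ [⟨(ρ.ivl i).lo, t, (ρ.ivl i).loC, true⟩],
   ρ.guards.take i, ρ.resets.take i⟩

/-- Two executions are equal up to time `t` if their prefixes up to `t` are identical. -/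
def EqUpTo (ρ₁ ρ₂ : RawExec α) (t : ℝ) : Prop := ρ₁.prefixUpTo t = ρ₂.prefixUpTo t

end RawExec

/-! ### HCMTL* syntax -/

/-- An interval annotating a temporal operator: endpoints from `α`, with `hi = none`
denoting `∞`. -/
structure FIvl (α : Type) where
  lo : α
  hi : Option α
  loC : Bool
  hiC : Bool

namespace FIvl
variable {α β : Type}

/-- `t ∈ base + I`. -/
def Mem (toR : α → ℝ) (base t : ℝ) (I : FIvl α) : Prop :=
  (if I.loC then base + toR I.lo ≤ t else base + toR I.lo < t) ∧
  (∀ h, I.hi = some h → (if I.hiC then t ≤ base + toR h else t < base + toR h))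

/-- A singular interval `[c, c]`. -/
def Singular (I : FIvl α) : Prop := I.loC = true ∧ I.hiC = true ∧ I.hi = some I.lo

def map (f : α → β) (I : FIvl α) : FIvl β := ⟨f I.lo, I.hi.map f, I.loC, I.hiC⟩

def consts (I : FIvl α) : List α := I.lo :: I.hi.toList

end FIvl

/-- HCMTL* formulas in negation normal form:
`φ ::= p_π | ¬p_π | φ ∨ φ | φ ∧ φ | F_I φ | G_I φ | φ U_I φ | ∃π φ | ∀π φ`.
Propositions and path variables are natural numbers; interval endpoints come from `α`. -/
inductive HF (α : Type) where
  | pos : ℕ → ℕ → HF α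
  | neg : ℕ → ℕ → HF α
  | disj : HF α → HF α → HF α
  | conj : HF α → HF α → HF α
  | fut : FIvl α → HF α → HF α
  | glob : FIvl α → HF α → HF α
  | untl : FIvl α → HF α → HF α → HF α
  | ex : ℕ → HF α → HF α
  | all : ℕ → HF α → HF α

namespace HF
variable {α β : Type}

/-- Free path variables. -/
def free : HF α → Finset ℕ
  | .pos _ π => {π}
  | .neg _ π => {π}
  | .disj a b => a.free ∪ b.free
  | .conj a b => a.free ∪ b.free
  | .fut _ a => a.free
  | .glob _ a => a.free
  | .untl _ a b => a.free ∪ b.free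
  | .ex π a => a.free.erase π
  | .all π a => a.free.erase π

/-- A sentence has no free path variables. -/
def Sentence (φ : HF α) : Prop := φ.free = ∅

/-- Quantifier-free formulas. -/
def QFree : HF α → Prop
  | .pos _ _ => True
  | .neg _ _ => True
  | .disj a b => a.QFree ∧ b.QFree
  | .conj a b => a.QFree ∧ b.QFree
  | .fut _ a => a.QFree
  | .glob _ a => a.QFree
  | .untl _ a b => a.QFree ∧ b.QFree
  | .ex _ _ => False
  | .all _ _ => False

/-- All intervals occurring in the formula are non-singular. -/
def NonSing : HF α → Prop
  | .pos _ _ => True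
  | .neg _ _ => True
  | .disj a b => a.NonSing ∧ b.NonSing
  | .conj a b => a.NonSing ∧ b.NonSing
  | .fut I a => ¬ I.Singular ∧ a.NonSing
  | .glob I a => ¬ I.Singular ∧ a.NonSing
  | .untl I a b => ¬ I.Singular ∧ a.NonSing ∧ b.NonSing
  | .ex _ a => a.NonSing
  | .all _ a => a.NonSing

/-- The HyperMITL fragment: all quantifiers at the top level, all intervals non-singular. -/
def HyperMITL : HF α → Prop
  | .ex _ a => a.HyperMITL
  | .all _ a => a.HyperMITL
  | φ => φ.QFree ∧ φ.NonSing

/-- Apply a function to every interval endpoint of the formula. -/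
def map (f : α → β) : HF α → HF β
  | .pos p π => .pos p π
  | .neg p π => .neg p π
  | .disj a b => .disj (a.map f) (b.map f)
  | .conj a b => .conj (a.map f) (b.map f)
  | .fut I a => .fut (I.map f) (a.map f)
  | .glob I a => .glob (I.map f) (a.map f)
  | .untl I a b => .untl (I.map f) (a.map f) (b.map f)
  | .ex π a => .ex π (a.map f)
  | .all π a => .all π (a.map f)

/-- The list of interval endpoints appearing in the formula. -/
def consts : HF α → List α
  | .pos _ _ => []
  | .neg _ _ => []
  | .disj a b => a.consts ++ b.consts
  | .conj a b => a.consts ++ b.consts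
  | .fut I a => I.consts ++ a.consts
  | .glob I a => I.consts ++ a.consts
  | .untl I a b => I.consts ++ a.consts ++ b.consts
  | .ex _ a => a.consts
  | .all _ a => a.consts

end HF

/-! ### HCMTL* interval-based semantics -/

/-- Time bound restriction: with `bd = some N`, only times `< N` are considered. -/
def inBd : Option ℝ → ℝ → Prop
  | none, _ => True
  | some N, t => t < N

/-- The interval-based satisfaction relation `Π, t, † ⊨_A φ` (with `bd = none`),
resp. its time-bounded variant `Π, t, † ⊨^N_A φ` (with `bd = some N`).
`d = none` represents `† = ε`, and `d = some π` represents `† = π`. -/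
def HSat {α : Type} (toR : α → ℝ) (A : TA α) (bd : Option ℝ) :
    HF α → (ℕ → RawExec α) → ℝ → Option ℕ → Prop
  | .pos p π, Env, t, _ =>
      RawExec.MemLen t (Env π) ∧ ∃ v, RawExec.StateAt (Env π) t v ∧ p ∈ A.labelOf v
  | .neg p π, Env, t, _ =>
      RawExec.MemLen t (Env π) ∧ ∃ v, RawExec.StateAt (Env π) t v ∧ p ∉ A.labelOf v
  | .disj a b, Env, t, d => HSat toR A bd a Env t d ∨ HSat toR A bd b Env t d
  | .conj a b, Env, t, d => HSat toR A bd a Env t d ∧ HSat toR A bd b Env t d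
  | .fut I a, Env, t, d => ∃ t', t < t' ∧ inBd bd t' ∧ FIvl.Mem toR t t' I ∧
      HSat toR A bd a Env t' d
  | .glob I a, Env, t, d => ∀ t', t < t' → inBd bd t' → FIvl.Mem toR t t' I →
      HSat toR A bd a Env t' d
  | .untl I a b, Env, t, d => ∃ t', t < t' ∧ inBd bd t' ∧ FIvl.Mem toR t t' I ∧
      HSat toR A bd b Env t' d ∧ ∀ t'', t < t'' → t'' < t' → HSat toR A bd a Env t'' d
  | .ex π a, Env, t, d => ∃ ρ, RawExec.InSem toR A bd ρ ∧
      ((d = none ∧ t = 0) ∨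
        ∃ d₀, d = some d₀ ∧ RawExec.MemLen t (Env d₀) ∧ RawExec.EqUpTo ρ (Env d₀) t) ∧
      HSat toR A bd a (Function.update Env π ρ) t (some π)
  | .all π a, Env, t, d => ∀ ρ, RawExec.InSem toR A bd ρ →
      ((d = none ∧ t = 0) ∨
        ∃ d₀, d = some d₀ ∧ RawExec.MemLen t (Env d₀) ∧ RawExec.EqUpTo ρ (Env d₀) t) →
      HSat toR A bd a (Function.update Env π ρ) t (some π)

/-! ### MSO(<, +1) -/

/-- MSO(<,+1) formulas over monadic predicate names `σ` and first-order variables `ℕ`: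
`φ ::= x < y | +1(x,y) | P(x) | φ ∨ φ | ¬φ | ∃x φ | ∃P φ`. -/
inductive MSO (σ : Type) where
  | lt : ℕ → ℕ → MSO σ
  | succ : ℕ → ℕ → MSO σ
  | app : σ → ℕ → MSO σ
  | disj : MSO σ → MSO σ → MSO σ
  | neg : MSO σ → MSO σ
  | exFO : ℕ → MSO σ → MSO σ
  | exSO : σ → MSO σ → MSO σ

/-- Continuity of a flow at `t` (within the time domain `D`). -/
def ContAt {σ : Type} (D : Set ℝ) (f : ℝ → Set σ) (t : ℝ) : Prop :=
  ∃ ε : ℝ, 0 < ε ∧ ∀ s ∈ D, |s - t| < ε → f s = f t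

/-- A flow is finitely variable: on every bounded interval it has only finitely many
discontinuities. -/
def FinVar {σ : Type} (D : Set ℝ) (f : ℝ → Set σ) : Prop :=
  ∀ a b : ℝ, Set.Finite {t | t ∈ D ∩ Set.Icc a b ∧ ¬ ContAt D f t}

namespace MSO
variable {σ : Type}

/-- Satisfaction `f, I ⊨ φ` of an MSO(<,+1) formula over the time domain `D`,
by a flow `f` and a first-order interpretation `ivar`. Second-order quantification
ranges over finitely variable flows agreeing with `f` except at the quantified predicate. -/
def Sat (D : Set ℝ) : MSO σ → (ℝ → Set σ) → (ℕ → ℝ) → Prop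
  | .lt x y, _, ivar => ivar x < ivar y
  | .succ x y, _, ivar => ivar y = ivar x + 1
  | .app P x, f, ivar => P ∈ f (ivar x)
  | .disj a b, f, ivar => Sat D a f ivar ∨ Sat D b f ivar
  | .neg a, f, ivar => ¬ Sat D a f ivar
  | .exFO x a, f, ivar => ∃ r ∈ D, Sat D a f (Function.update ivar x r)
  | .exSO P a, f, ivar => ∃ g : ℝ → Set σ, FinVar D g ∧
      (∀ t ∈ D, ∀ Q, Q ≠ P → (Q ∈ g t ↔ Q ∈ f t)) ∧ Sat D a g ivar

/-- Free first-order variables. -/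
def freeFO : MSO σ → Finset ℕ
  | .lt x y => {x, y}
  | .succ x y => {x, y}
  | .app _ x => {x}
  | .disj a b => a.freeFO ∪ b.freeFO
  | .neg a => a.freeFO
  | .exFO x a => a.freeFO.erase x
  | .exSO _ a => a.freeFO

/-- Free monadic (second-order) predicates. -/
def freeSO [DecidableEq σ] : MSO σ → Finset σ
  | .lt _ _ => ∅
  | .succ _ _ => ∅
  | .app P _ => {P}
  | .disj a b => a.freeSO ∪ b.freeSO
  | .neg a => a.freeSO
  | .exFO _ a => a.freeSO
  | .exSO P a => a.freeSO.erase P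

/-- Purely first-order formulas: no monadic predicates occur at all. -/
def FOonly : MSO σ → Prop
  | .lt _ _ => True
  | .succ _ _ => True
  | .app _ _ => False
  | .disj a b => a.FOonly ∧ b.FOonly
  | .neg a => a.FOonly
  | .exFO _ a => a.FOonly
  | .exSO _ _ => False

end MSO

/-! ### The monadic predicates `MP = V ∪ T ∪ R` and the encoding ι of executions as flows -/

/-- The monadic predicates associated to a timed automaton: states `v`, transition markers
`T⁻_e`, `T⁺_e` for edges `e`, and reset markers `R⁰_x`, `R¹_x` for clocks `x`. -/
inductive MPred (α : Type) where
  | st : ℕ → MPred α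
  | tminus : IEdge α → MPred α
  | tplus : IEdge α → MPred α
  | r0 : ℕ → MPred α
  | r1 : ℕ → MPred α
  deriving DecidableEq

/-- The encoding `ι_A` of an execution as a flow over `MP = V ∪ T ∪ R`:
at each time, the current state; at a `T⁻` transition time `t = L(I_{i+1}) ∈ I_{i+1}`,
the marker `T⁻_e` and resets `R⁰_x` (for the clocks `x` reset by `e`);
at a `T⁺` transition time `t = R(I_i) ∈ I_i`, the marker `T⁺_e` and resets `R¹_x`;
and `∅` after the execution has ended. -/
def iota {α : Type} (ρ : RawExec α) (t : ℝ) : Set (MPred α) :=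
  {mp | match mp with
    | .st v => RawExec.StateAt ρ t v
    | .tminus e => ∃ i, i + 1 < ρ.n ∧ ρ.edge i = e ∧
        t = (ρ.ivl (i+1)).lo ∧ TIvl.Mem t (ρ.ivl (i+1))
    | .tplus e => ∃ i, i + 1 < ρ.n ∧ ρ.edge i = e ∧
        t = (ρ.ivl i).hi ∧ TIvl.Mem t (ρ.ivl i)
    | .r0 x => ∃ i, i + 1 < ρ.n ∧ x ∈ ρ.reset i ∧
        t = (ρ.ivl (i+1)).lo ∧ TIvl.Mem t (ρ.ivl (i+1))
    | .r1 x => ∃ i, i + 1 < ρ.n ∧ x ∈ ρ.reset i ∧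
        t = (ρ.ivl i).hi ∧ TIvl.Mem t (ρ.ivl i)}

/-- The combined flow `f_Π` of a path environment `Π` on path variables `1, …, m`,
over the pairwise disjoint indexed copies `MP_1 ∪ ⋯ ∪ MP_m` (tagged by the index). -/
def fPi (m : ℕ) (Env : ℕ → RawExec ℕ) : ℝ → Set (ℕ × MPred ℕ) :=
  fun t => {q | 1 ≤ q.1 ∧ q.1 ≤ m ∧ q.2 ∈ iota (Env q.1) t}

end HyTime

namespace HyTime

/-! ### Timed automata in the point-based semantics -/

/-- A transition of a point-based timed automaton: source state, event (a set of
propositions), guard, reset set, destination state. -/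
abbrev PEdge (α : Type) := ℕ × List ℕ × List (ℕ × ClkC α) × List ℕ × ℕ

def PEdge.src {α : Type} (e : PEdge α) : ℕ := e.1
def PEdge.event {α : Type} (e : PEdge α) : List ℕ := e.2.1
def PEdge.guard {α : Type} (e : PEdge α) : List (ℕ × ClkC α) := e.2.2.1
def PEdge.rst {α : Type} (e : PEdge α) : List ℕ := e.2.2.2.1
def PEdge.dst {α : Type} (e : PEdge α) : ℕ := e.2.2.2.2

/-- A timed automaton in the point-based semantics `B = (𝒫(P), S, s₀, X, Δ, F)`. -/
structure PTA (α : Type) where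
  states : List ℕ
  start : ℕ
  props : List ℕ
  clocks : List ℕ
  trans : List (PEdge α)
  final : List ℕ

/-- The raw data of a run `(s₀,μ₀) →^{e₁,t₁} ⋯ →^{eₙ,tₙ} (sₙ,μₙ)`:
the transitions taken and their times. -/
structure PRun (α : Type) where
  edges : List (PEdge α)
  times : List ℝ
  deriving Inhabited

namespace PRun
variable {α : Type}

def n (η : PRun α) : ℕ := η.edges.length
def edge (η : PRun α) (i : ℕ) : PEdge α := η.edges.getD i default
def time (η : PRun α) (i : ℕ) : ℝ := η.times.getD i 0
def tprev (η : PRun α) (i : ℕ) : ℝ := if i = 0 then 0 else η.time (i - 1)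

/-- The clock valuation `μ_i` after `i` transitions. -/
def mu (η : PRun α) : ℕ → ℕ → ℝ
  | 0, _ => 0
  | i+1, x => if x ∈ PEdge.rst (η.edge i) then 0 else η.mu i x + (η.time i - η.tprev i)

/-- `η` is a run of `B`: nonempty, increasing nonnegative transition times,
starting at the start state, consecutive transitions of `Δ`, guards holding at
transition times. -/
def IsRun (toR : α → ℝ) (B : PTA α) (η : PRun α) : Prop :=
  0 < η.n ∧ η.times.length = η.n ∧
  0 ≤ η.time 0 ∧ (∀ i, i + 1 < η.n → η.time i < η.time (i+1)) ∧
  PEdge.src (η.edge 0) = B.start ∧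
  (∀ i, i < η.n → η.edge i ∈ B.trans) ∧
  (∀ i, i + 1 < η.n → PEdge.src (η.edge (i+1)) = PEdge.dst (η.edge i)) ∧
  (∀ i, i < η.n → ∀ q ∈ PEdge.guard (η.edge i),
    ClkC.holds toR (η.mu i q.1 + (η.time i - η.tprev i)) q.2)

/-- An accepting run: ends in a final state. -/
def IsAccRun (toR : α → ℝ) (B : PTA α) (η : PRun α) : Prop :=
  η.IsRun toR B ∧ PEdge.dst (η.edge (η.n - 1)) ∈ B.final

/-- The duration `len(η) = tₙ` of a run. -/
def len (η : PRun α) : ℝ := η.time (η.n - 1)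

/-- All transition times are `< N`. -/
def BoundedBy (η : PRun α) (N : ℝ) : Prop := ∀ i, i < η.n → η.time i < N

/-- Membership in `Runs(B)` (if `bd = none`) resp. its bounded variant. -/
def InSem (toR : α → ℝ) (B : PTA α) (bd : Option ℝ) (η : PRun α) : Prop :=
  η.IsAccRun toR B ∧ ∀ N, bd = some N → η.BoundedBy N

/-- `t ∈ η`: `t` is one of the transition (event) times of `η`. -/
def EvtTime (η : PRun α) (t : ℝ) : Prop := ∃ i, i < η.n ∧ η.time i = t

/-- `η'` is an extension of `η` from time `t`: they agree on all transitions at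
times `≤ t`, and all later transitions (of either run) occur after `t`. -/
def ExtendsFrom (η' η : PRun α) (t : ℝ) : Prop :=
  ∃ i, i ≤ η.n ∧ i ≤ η'.n ∧
    η'.edges.take i = η.edges.take i ∧ η'.times.take i = η.times.take i ∧
    (∀ j, j < i → η.time j ≤ t) ∧
    (∀ j, i ≤ j → j < η.n → t < η.time j) ∧
    (∀ j, i ≤ j → j < η'.n → t < η'.time j)

end PRun

/-! ### HCMTL* point-based semantics -/

/-- The point-based satisfaction relation `Γ, t, † ⊨_B φ` (with `bd = none`),
resp. its time-bounded variant (with `bd = some N`). `V` is the current set of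
path variables (the domain of the environment `Γ`); temporal operators range only
over event points of the runs in `Γ`. -/
def PSat {α : Type} (toR : α → ℝ) (B : PTA α) (bd : Option ℝ) :
    HF α → Finset ℕ → (ℕ → PRun α) → ℝ → Option ℕ → Prop
  | .pos p π, _, Γ, t, _ =>
      ∃ i, i < (Γ π).n ∧ (Γ π).time i = t ∧ p ∈ PEdge.event ((Γ π).edge i)
  | .neg p π, _, Γ, t, _ =>
      ∃ i, i < (Γ π).n ∧ (Γ π).time i = t ∧ p ∉ PEdge.event ((Γ π).edge i)
  | .disj a b, V, Γ, t, d => PSat toR B bd a V Γ t d ∨ PSat toR B bd b V Γ t d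
  | .conj a b, V, Γ, t, d => PSat toR B bd a V Γ t d ∧ PSat toR B bd b V Γ t d
  | .fut I a, V, Γ, t, d => ∃ t', t < t' ∧ inBd bd t' ∧ FIvl.Mem toR t t' I ∧
      (∃ π ∈ V, PRun.EvtTime (Γ π) t') ∧ PSat toR B bd a V Γ t' d
  | .glob I a, V, Γ, t, d => ∀ t', t < t' → inBd bd t' → FIvl.Mem toR t t' I →
      (∃ π ∈ V, PRun.EvtTime (Γ π) t') → PSat toR B bd a V Γ t' d
  | .untl I a b, V, Γ, t, d => ∃ t', t < t' ∧ inBd bd t' ∧ FIvl.Mem toR t t' I ∧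
      (∃ π ∈ V, PRun.EvtTime (Γ π) t') ∧ PSat toR B bd b V Γ t' d ∧
      (∀ t'', t < t'' → t'' < t' → (∃ π ∈ V, PRun.EvtTime (Γ π) t'') →
        PSat toR B bd a V Γ t'' d)
  | .ex π a, V, Γ, t, d => ∃ η, PRun.InSem toR B bd η ∧
      ((d = none ∧ t = 0) ∨
        ∃ d₀, d = some d₀ ∧ t ≤ PRun.len (Γ d₀) ∧ PRun.ExtendsFrom η (Γ d₀) t) ∧
      PSat toR B bd a (insert π V) (Function.update Γ π η) t (some π)
  | .all π a, V, Γ, t, d => ∀ η, PRun.InSem toR B bd η →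
      ((d = none ∧ t = 0) ∨
        ∃ d₀, d = some d₀ ∧ t ≤ PRun.len (Γ d₀) ∧ PRun.ExtendsFrom η (Γ d₀) t) →
      PSat toR B bd a (insert π V) (Function.update Γ π η) t (some π)

/-! ### Concrete injective encodings of syntax into ℕ -/

def encList {α : Type} (f : α → ℕ) : List α → ℕ
  | [] => 0
  | a :: l => Nat.pair (f a) (encList f l) + 1

def encClkC : ClkC ℕ → ℕ
  | .atom c k => Nat.pair 0 (Nat.pair c.code k)
  | .disj a b => Nat.pair 1 (Nat.pair (encClkC a) (encClkC b))
  | .conj a b => Nat.pair 2 (Nat.pair (encClkC a) (encClkC b))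

def encGuard (g : List (ℕ × ClkC ℕ)) : ℕ := encList (fun q => Nat.pair q.1 (encClkC q.2)) g

def encIEdge (e : IEdge ℕ) : ℕ :=
  Nat.pair e.1 (Nat.pair e.2.1 (Nat.pair (encGuard e.2.2.1) (encList id e.2.2.2)))

/-- Injective encoding of timed automata as natural numbers. -/
def encTA (A : TA ℕ) : ℕ :=
  Nat.pair (encList id A.states) <| Nat.pair (encList id A.init) <|
  Nat.pair (encList id A.props) <| Nat.pair (encList id A.clocks) <|
  Nat.pair (encList (fun q => Nat.pair q.1 (encList id q.2)) A.label) <|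
  Nat.pair (encList (fun q => Nat.pair (Nat.pair q.1.1 q.1.2) (encClkC q.2)) A.beta) <|
  Nat.pair (encList encIEdge A.edges) (encList id A.final)

def encFIvl (I : FIvl ℕ) : ℕ :=
  Nat.pair I.lo <| Nat.pair (match I.hi with | none => 0 | some h => h + 1) <|
  Nat.pair I.loC.toNat I.hiC.toNat

/-- Injective encoding of HCMTL* formulas as natural numbers. -/
def encHF : HF ℕ → ℕ
  | .pos p π => Nat.pair 0 (Nat.pair p π)
  | .neg p π => Nat.pair 1 (Nat.pair p π)
  | .disj a b => Nat.pair 2 (Nat.pair (encHF a) (encHF b))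
  | .conj a b => Nat.pair 3 (Nat.pair (encHF a) (encHF b))
  | .fut I a => Nat.pair 4 (Nat.pair (encFIvl I) (encHF a))
  | .glob I a => Nat.pair 5 (Nat.pair (encFIvl I) (encHF a))
  | .untl I a b => Nat.pair 6 (Nat.pair (encFIvl I) (Nat.pair (encHF a) (encHF b)))
  | .ex π a => Nat.pair 7 (Nat.pair π (encHF a))
  | .all π a => Nat.pair 8 (Nat.pair π (encHF a))

def encPEdge (e : PEdge ℕ) : ℕ :=
  Nat.pair (PEdge.src e) <| Nat.pair (encList id (PEdge.event e)) <|
  Nat.pair (encGuard (PEdge.guard e)) <| Nat.pair (encList id (PEdge.rst e)) (PEdge.dst e)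

/-- Injective encoding of point-based timed automata as natural numbers. -/
def encPTA (B : PTA ℕ) : ℕ :=
  Nat.pair (encList id B.states) <| Nat.pair B.start <| Nat.pair (encList id B.props) <|
  Nat.pair (encList id B.clocks) <| Nat.pair (encList encPEdge B.trans) (encList id B.final)

/-- Injective encoding of MSO(<,+1) formulas as natural numbers. -/
def encMSO : MSO ℕ → ℕ
  | .lt x y => Nat.pair 0 (Nat.pair x y)
  | .succ x y => Nat.pair 1 (Nat.pair x y)
  | .app P x => Nat.pair 2 (Nat.pair P x)
  | .disj a b => Nat.pair 3 (Nat.pair (encMSO a) (encMSO b))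
  | .neg a => Nat.pair 4 (encMSO a)
  | .exFO x a => Nat.pair 5 (Nat.pair x (encMSO a))
  | .exSO P a => Nat.pair 6 (Nat.pair P (encMSO a))

/-! ### The interval-based automaton ⟦B⟧ associated to a point-based automaton B -/

/-- Code of an original state of `B` as a state of `⟦B⟧`. -/
def stCode (s : ℕ) : ℕ := 2 * s
/-- Code of a transition of `B` as a (transition-)state of `⟦B⟧`. -/
def edCode (e : PEdge ℕ) : ℕ := 2 * encPEdge e + 1
/-- The fresh proposition `#` marking transition-states. -/
def hashProp : ℕ := 0
/-- Code of an original proposition of `B` as a proposition of `⟦B⟧`. -/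
def propCode (p : ℕ) : ℕ := 2 * p + 1
/-- Code of a state of `B` as a proposition of `⟦B⟧` (over `P ∪ S ∪ {#}`). -/
def stPropCode (s : ℕ) : ℕ := 2 * s + 2
/-- Code of an original clock of `B` as a clock of `⟦B⟧`. -/
def clkCode (x : ℕ) : ℕ := x + 1
/-- The fresh clock `x_sing` forcing transition-states to be singular. -/
def xsing : ℕ := 0

/-- The interval-based timed automaton `⟦B⟧` over `P ∪ S ∪ {#}`: its states are the
states of `B` together with the transitions of `B`; transition-states are labeled by
their event together with `#`, carry the guard constraints and the constraint
`x_sing = 0`; edges alternate between states and transition-states, resetting `x_sing`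
on entry to a transition-state and the transition's resets on exit. -/
def ibOf (B : PTA ℕ) : TA ℕ where
  states := B.states.map stCode ++ B.trans.map edCode
  init := stCode B.start :: (B.trans.filter (fun e => PEdge.src e == B.start)).map edCode
  props := hashProp :: (B.props.map propCode ++ B.states.map stPropCode)
  clocks := xsing :: B.clocks.map clkCode
  label := B.states.map (fun s => (stCode s, [stPropCode s])) ++
    B.trans.map (fun e => (edCode e, hashProp :: (PEdge.event e).map propCode))
  beta := B.trans.map (fun e => ((edCode e, xsing), ClkC.atom Cmp.eq 0)) ++
    B.trans.flatMap (fun e => B.clocks.filterMap (fun x =>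
      match (PEdge.guard e).filter (fun q => q.1 == x) with
      | [] => none
      | q :: rest =>
          some ((edCode e, clkCode x), rest.foldl (fun acc r => ClkC.conj acc r.2) q.2)))
  edges := B.trans.flatMap (fun e =>
    [(stCode (PEdge.src e), edCode e, [], [xsing]),
     (edCode e, stCode (PEdge.dst e), [], (PEdge.rst e).map clkCode)])
  final := (B.trans.filter (fun e => B.final.contains (PEdge.dst e))).map edCode

/-- The map `χ` sending a run `(s₀,μ₀) →^{e₁,t₁} ⋯ →^{eₙ,tₙ} (sₙ,μₙ)` of `B` to the
execution `(s₀,[0,t₁)), (e₁,[t₁,t₁]), (s₁,(t₁,t₂)), …, (eₙ,[tₙ,tₙ])` of `⟦B⟧`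
(starting at `(e₁,[0,0])` if `t₁ = 0`). -/
noncomputable def chi (η : PRun ℕ) : RawExec ℕ :=
  let n := η.n
  let sts := η.edges.flatMap (fun e => [stCode (PEdge.src e), edCode e])
  let ivls := (List.range n).flatMap (fun i =>
    [⟨η.tprev i, η.time i, decide (i = 0), false⟩, ⟨η.time i, η.time i, true, true⟩])
  let gds : List (List (ℕ × ClkC ℕ)) := List.replicate (2 * n - 1) []
  let rsts := ((List.range n).flatMap
    (fun i => [[xsing], (PEdge.rst (η.edge i)).map clkCode])).take (2 * n - 1)
  if η.time 0 = 0 then ⟨sts.tail, ivls.tail, gds.tail, rsts.tail⟩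
  else ⟨sts, ivls, gds, rsts⟩

end HyTime

namespace HyTime

namespace TIvl

/-- The cut of the time line just before an interval: `(t, false)` is the cut immediately
before `t`, and `(t, true)` the cut immediately after `t`. -/
noncomputable def lowerCut (I : TIvl) : ℝ ×ₗ Bool := toLex (I.lo, !I.loC)

/-- The cut of the time line just after an interval. -/
noncomputable def upperCut (I : TIvl) : ℝ ×ₗ Bool := toLex (I.hi, I.hiC)

theorem beforeCut_lt_afterCut (t : ℝ) : (toLex (t, false) : ℝ ×ₗ Bool) < toLex (t, true) := by
  simp [Prod.Lex.toLex_lt_toLex]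

theorem exists_time_between_cuts {c d : ℝ ×ₗ Bool} (h : c < d) :
    ∃ t : ℝ, c ≤ toLex (t, false) ∧ toLex (t, true) ≤ d := by
  obtain ⟨x, b⟩ := c
  obtain ⟨y, b'⟩ := d
  rcases Prod.Lex.toLex_lt_toLex.1 h with hxy | ⟨hxy, hb⟩
  · obtain ⟨t, hxt, hty⟩ := exists_between hxy
    exact ⟨t, Prod.Lex.toLex_le_toLex.2 (Or.inl hxt), Prod.Lex.toLex_le_toLex.2 (Or.inl hty)⟩
  · simp only at hxy hb
    subst hxy
    obtain ⟨rfl, rfl⟩ := Bool.lt_iff.1 hb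
    exact ⟨x, le_rfl, le_rfl⟩

theorem mem_iff_cuts {t : ℝ} {I : TIvl} :
    Mem t I ↔ I.lowerCut ≤ toLex (t, false) ∧ toLex (t, true) ≤ I.upperCut := by
  obtain ⟨lo, hi, loC, hiC⟩ := I
  cases loC <;> cases hiC <;>
    simp [Mem, lowerCut, upperCut, Prod.Lex.toLex_lt_toLex, le_iff_lt_or_eq, Bool.lt_iff]

theorem wf_iff_cuts {I : TIvl} : I.WF ↔ I.lowerCut < I.upperCut := by
  obtain ⟨lo, hi, loC, hiC⟩ := I
  cases loC <;> cases hiC <;> simp [WF, lowerCut, upperCut, Prod.Lex.toLex_lt_toLex]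

theorem consecutive_iff_cuts {I J : TIvl} : I.Consecutive J ↔ I.upperCut = J.lowerCut := by
  simp [Consecutive, lowerCut, upperCut]

theorem ext_cuts {I J : TIvl} (hl : I.lowerCut = J.lowerCut) (hu : I.upperCut = J.upperCut) :
    I = J := by
  obtain ⟨lo, hi, loC, hiC⟩ := I
  obtain ⟨lo', hi', loC', hiC'⟩ := J
  simp_all [lowerCut, upperCut]

theorem upperCut_le_of_subset {I J : TIvl} (hI : I.WF)
    (h : ∀ t, Mem t I → Mem t J) : I.upperCut ≤ J.upperCut := by
  by_contra! hlt
  obtain ⟨t, h₁, h₂⟩ := exists_time_between_cuts (max_lt hlt (wf_iff_cuts.1 hI))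
  have hJ := (mem_iff_cuts.1 (h t (mem_iff_cuts.2 ⟨(le_max_right _ _).trans h₁, h₂⟩))).2
  exact (hJ.trans ((le_max_left _ _).trans h₁)).not_gt (beforeCut_lt_afterCut t)

/-- Two times that are not endpoints of `I` and are not separated by an endpoint of `I` are
both in `I` or both outside `I`. -/
theorem mem_congr {s t : ℝ} {I : TIvl} (hlo : s < I.lo ∧ t < I.lo ∨ I.lo < s ∧ I.lo < t)
    (hhi : s < I.hi ∧ t < I.hi ∨ I.hi < s ∧ I.hi < t) : Mem s I ↔ Mem t I := by
  unfold Mem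
  split_ifs <;> grind

end TIvl

theorem list_ext_getD {β : Type*} {l₁ l₂ : List β} {d : β} (hlen : l₁.length = l₂.length)
    (h : ∀ i, i < l₁.length → l₁.getD i d = l₂.getD i d) : l₁ = l₂ :=
  List.ext_getElem hlen fun i hi₁ hi₂ => by
    simpa only [List.getD_eq_getElem _ _ hi₁, List.getD_eq_getElem _ _ hi₂] using h i hi₁

namespace RawExec
variable {α : Type}

theorem finVar_iota (D : Set ℝ) (ρ : RawExec α) : FinVar D (iota ρ) := by
  intro a b
  set S : Set ℝ := (fun i => (ρ.ivl i).lo) '' Set.Iio ρ.n ∪ (fun i => (ρ.ivl i).hi) '' Set.Iio ρ.n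
  have hfin : S.Finite := ((Set.finite_Iio _).image _).union ((Set.finite_Iio _).image _)
  refine hfin.subset fun t ⟨_, ht⟩ => ?_
  by_contra htS
  obtain ⟨ε, hε, hball⟩ := Metric.isOpen_iff.1 hfin.isClosed.isOpen_compl t htS
  refine ht ⟨ε, hε, fun s _ hs => ?_⟩
  have key : ∀ p ∈ S, s < p ∧ t < p ∨ p < s ∧ p < t := by
    intro p hp
    have hp' : ε ≤ |p - t| := not_lt.1 fun h => hball (Metric.mem_ball.2 h) hp
    rw [abs_lt] at hs
    rcases le_abs.1 hp' with h | h
    · left; constructor <;> linarith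
    · right; constructor <;> linarith
  have hlo : ∀ i, i < ρ.n → _ := fun i hi => key (ρ.ivl i).lo (Or.inl ⟨i, hi, rfl⟩)
  have hhi : ∀ i, i < ρ.n → _ := fun i hi => key (ρ.ivl i).hi (Or.inr ⟨i, hi, rfl⟩)
  ext mp
  cases mp with
  | st v =>
    exact exists_congr fun i => and_congr_right fun hi =>
      and_congr_left fun _ => TIvl.mem_congr (hlo i hi) (hhi i hi)
  | tminus e => simp only [iota, Set.mem_ofPred_eq]; grind
  | tplus e => simp only [iota, Set.mem_ofPred_eq]; grind
  | r0 x => simp only [iota, Set.mem_ofPred_eq]; grind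
  | r1 x => simp only [iota, Set.mem_ofPred_eq]; grind

namespace IsExec

variable {toR : α → ℝ} {A : TA α} {ρ : RawExec α}

theorem wf (h : ρ.IsExec toR A) {i : ℕ} (hi : i < ρ.n) : (ρ.ivl i).WF :=
  h.2.2.2.2.2.2.1 i hi

theorem lowerCut_zero (h : ρ.IsExec toR A) : (ρ.ivl 0).lowerCut = toLex (0, false) := by
  simp [TIvl.lowerCut, h.2.2.2.2.1, h.2.2.2.2.2.1]

theorem upperCut_eq_lowerCut_succ (h : ρ.IsExec toR A) {i : ℕ} (hi : i + 1 < ρ.n) :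
    (ρ.ivl i).upperCut = (ρ.ivl (i + 1)).lowerCut :=
  TIvl.consecutive_iff_cuts.1 (h.2.2.2.2.2.2.2.1 i hi)

theorem upperCut_lt_upperCut (h : ρ.IsExec toR A) {i j : ℕ} (hij : i < j) (hj : j < ρ.n) :
    (ρ.ivl i).upperCut < (ρ.ivl j).upperCut := by
  have step : ∀ k, k + 1 < ρ.n → (ρ.ivl k).upperCut < (ρ.ivl (k + 1)).upperCut := fun k hk =>
    h.upperCut_eq_lowerCut_succ hk ▸ TIvl.wf_iff_cuts.1 (h.wf hk)
  induction j, hij using Nat.le_induction with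
  | base => exact step i hj
  | succ j _ ih => exact (ih (by omega)).trans (step j hj)

theorem upperCut_injective (h : ρ.IsExec toR A) {i j : ℕ} (hi : i < ρ.n) (hj : j < ρ.n)
    (hij : (ρ.ivl i).upperCut = (ρ.ivl j).upperCut) : i = j := by
  rcases lt_trichotomy i j with hlt | heq | hgt
  · exact absurd hij (h.upperCut_lt_upperCut hlt hj).ne
  · exact heq
  · exact absurd hij (h.upperCut_lt_upperCut hgt hi).ne'

theorem not_mem_of_mem_of_lt (h : ρ.IsExec toR A) {t : ℝ} {i j : ℕ} (hij : i < j)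
    (hj : j < ρ.n) (hi : TIvl.Mem t (ρ.ivl i)) : ¬ TIvl.Mem t (ρ.ivl j) := by
  intro hmem
  obtain ⟨k, rfl⟩ : ∃ k, j = k + 1 := ⟨j - 1, by omega⟩
  have hik : (ρ.ivl i).upperCut ≤ (ρ.ivl k).upperCut := by
    rcases (Nat.le_of_lt_succ hij).lt_or_eq with hlt | rfl
    · exact (h.upperCut_lt_upperCut hlt (by omega)).le
    · exact le_rfl
  rw [h.upperCut_eq_lowerCut_succ hj] at hik
  exact (((TIvl.mem_iff_cuts.1 hi).2.trans hik).trans (TIvl.mem_iff_cuts.1 hmem).1).not_gt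
    (TIvl.beforeCut_lt_afterCut t)

end IsExec

/-- The transition marker for the edge `e` at a cut before (`false`) or after (`true`) a
point of time. -/
def marker (b : Bool) (e : IEdge α) : MPred α := bif b then .tplus e else .tminus e

theorem IsExec.marker_mem_iota {toR : α → ℝ} {A : TA α} {ρ : RawExec α} (h : ρ.IsExec toR A)
    {b : Bool} {e : IEdge α} {t : ℝ} :
    marker b e ∈ iota ρ t ↔
      ∃ i, i + 1 < ρ.n ∧ ρ.edge i = e ∧ (ρ.ivl i).upperCut = toLex (t, b) := by
  cases b with
  | false =>
    refine exists_congr fun i => and_congr_right fun hi => and_congr_right fun _ => ?_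
    have hwf := h.wf hi
    rw [h.upperCut_eq_lowerCut_succ hi]
    generalize ρ.ivl (i + 1) = I at *
    obtain ⟨lo, hi, loC, hiC⟩ := I
    cases loC <;> cases hiC <;> simp_all [TIvl.Mem, TIvl.WF, TIvl.lowerCut] <;> grind
  | true =>
    refine exists_congr fun i => and_congr_right fun hi => and_congr_right fun _ => ?_
    have hwf := h.wf (Nat.lt_of_succ_lt hi)
    generalize ρ.ivl i = I at *
    obtain ⟨lo, hi, loC, hiC⟩ := I
    cases loC <;> cases hiC <;> simp_all [TIvl.Mem, TIvl.WF, TIvl.upperCut] <;> grind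

/-- The cuts at which the transitions of an execution are taken. -/
noncomputable def transCuts (ρ : RawExec α) : List (ℝ ×ₗ Bool) :=
  (List.range (ρ.n - 1)).map fun i => (ρ.ivl i).upperCut

theorem IsExec.sortedLT_transCuts {toR : α → ℝ} {A : TA α} {ρ : RawExec α}
    (h : ρ.IsExec toR A) : ρ.transCuts.SortedLT := by
  rw [List.sortedLT_iff_getElem_lt_getElem_of_lt]
  intro i j hi hj hij
  simp only [transCuts, List.length_map, List.length_range] at hj
  simpa [transCuts] using h.upperCut_lt_upperCut hij (by omega)

theorem IsExec.mem_transCuts {toR : α → ℝ} {A : TA α} {ρ : RawExec α} (h : ρ.IsExec toR A)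
    {t : ℝ} {b : Bool} : toLex (t, b) ∈ ρ.transCuts ↔ ∃ e, marker b e ∈ iota ρ t := by
  simp only [h.marker_mem_iota, transCuts, List.mem_map, List.mem_range]
  constructor
  · rintro ⟨i, hi, hc⟩
    exact ⟨_, i, by omega, rfl, hc⟩
  · rintro ⟨_, i, hi, _, hc⟩
    exact ⟨i, by omega, hc⟩

section Injective

variable {toR : α → ℝ} {A : TA α} {ρ₁ ρ₂ : RawExec α}

theorem IsExec.transCuts_eq (h₁ : ρ₁.IsExec toR A) (h₂ : ρ₂.IsExec toR A)
    (hι : iota ρ₁ = iota ρ₂) : ρ₁.transCuts = ρ₂.transCuts :=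
  h₁.sortedLT_transCuts.eq_of_mem_iff h₂.sortedLT_transCuts fun c =>
    (h₁.mem_transCuts (t := c.1) (b := c.2)).trans
      (by rw [hι]; exact h₂.mem_transCuts.symm)

theorem IsExec.n_eq (h₁ : ρ₁.IsExec toR A) (h₂ : ρ₂.IsExec toR A)
    (hι : iota ρ₁ = iota ρ₂) : ρ₁.n = ρ₂.n := by
  have hlen := congrArg List.length (h₁.transCuts_eq h₂ hι)
  simp only [transCuts, List.length_map, List.length_range] at hlen
  have := h₁.1
  have := h₂.1
  omega

theorem IsExec.upperCut_eq (h₁ : ρ₁.IsExec toR A) (h₂ : ρ₂.IsExec toR A)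
    (hι : iota ρ₁ = iota ρ₂) {i : ℕ} (hi : i + 1 < ρ₁.n) :
    (ρ₁.ivl i).upperCut = (ρ₂.ivl i).upperCut := by
  have h := h₁.transCuts_eq h₂ hι
  simp only [transCuts, ← h₁.n_eq h₂ hι] at h
  exact List.map_inj_left.1 h i (List.mem_range.2 (by omega))

theorem IsExec.edge_eq (h₁ : ρ₁.IsExec toR A) (h₂ : ρ₂.IsExec toR A)
    (hι : iota ρ₁ = iota ρ₂) {i : ℕ} (hi : i + 1 < ρ₁.n) : ρ₁.edge i = ρ₂.edge i := by
  have hmem := h₁.marker_mem_iota.2 ⟨i, hi, rfl, rfl⟩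
  rw [hι, h₂.marker_mem_iota] at hmem
  obtain ⟨j, hj, he, hc⟩ := hmem
  have hn := h₁.n_eq h₂ hι
  have hji : j = i := h₂.upperCut_injective (by omega) (by omega)
    (hc.trans (h₁.upperCut_eq h₂ hι hi))
  rw [← he, hji]

theorem IsExec.lowerCut_eq (h₁ : ρ₁.IsExec toR A) (h₂ : ρ₂.IsExec toR A)
    (hι : iota ρ₁ = iota ρ₂) {i : ℕ} (hi : i < ρ₁.n) :
    (ρ₁.ivl i).lowerCut = (ρ₂.ivl i).lowerCut := by
  cases i with
  | zero => rw [h₁.lowerCut_zero, h₂.lowerCut_zero]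
  | succ i =>
    rw [← h₁.upperCut_eq_lowerCut_succ hi, h₁.upperCut_eq h₂ hι hi,
      h₂.upperCut_eq_lowerCut_succ (h₁.n_eq h₂ hι ▸ hi)]

theorem memLen_iff_iota {ρ : RawExec α} {t : ℝ} :
    MemLen t ρ ↔ ∃ v, MPred.st v ∈ iota ρ t :=
  ⟨fun ⟨i, hi, hm⟩ => ⟨_, i, hi, hm, rfl⟩, fun ⟨_, i, hi, hm, _⟩ => ⟨i, hi, hm⟩⟩

theorem IsExec.upperCut_last_le (h₁ : ρ₁.IsExec toR A) (h₂ : ρ₂.IsExec toR A)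
    (hι : iota ρ₁ = iota ρ₂) {i : ℕ} (hi : i + 1 = ρ₁.n) :
    (ρ₁.ivl i).upperCut ≤ (ρ₂.ivl i).upperCut := by
  have hn := h₁.n_eq h₂ hι
  refine TIvl.upperCut_le_of_subset (h₁.wf (by omega)) fun t ht => ?_
  have hlen : MemLen t ρ₂ := by
    rw [memLen_iff_iota, ← hι, ← memLen_iff_iota]
    exact ⟨i, by omega, ht⟩
  obtain ⟨j, hj, htj⟩ := hlen
  rcases (show j ≤ i by omega).lt_or_eq with hji | rfl
  · rw [← TIvl.ext_cuts (h₁.lowerCut_eq h₂ hι (by omega)) (h₁.upperCut_eq h₂ hι (by omega))]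
      at htj
    exact absurd ht (h₁.not_mem_of_mem_of_lt hji (by omega) htj)
  · exact htj

theorem IsExec.ivl_eq (h₁ : ρ₁.IsExec toR A) (h₂ : ρ₂.IsExec toR A)
    (hι : iota ρ₁ = iota ρ₂) {i : ℕ} (hi : i < ρ₁.n) : ρ₁.ivl i = ρ₂.ivl i := by
  refine TIvl.ext_cuts (h₁.lowerCut_eq h₂ hι hi) ?_
  rcases (Nat.succ_le_of_lt hi).lt_or_eq with hlt | heq
  · exact h₁.upperCut_eq h₂ hι hlt
  · exact (h₁.upperCut_last_le h₂ hι heq).antisymm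
      (h₂.upperCut_last_le h₁ hι.symm (heq.trans (h₁.n_eq h₂ hι)))

theorem IsExec.state_eq (h₁ : ρ₁.IsExec toR A) (h₂ : ρ₂.IsExec toR A)
    (hι : iota ρ₁ = iota ρ₂) {i : ℕ} (hi : i < ρ₁.n) : ρ₁.state i = ρ₂.state i := by
  cases i with
  | succ i => exact congrArg (fun e => e.2.1) (h₁.edge_eq h₂ hι hi)
  | zero =>
    have hn := h₁.n_eq h₂ hι
    obtain ⟨t, ht⟩ := TIvl.exists_time_between_cuts (TIvl.wf_iff_cuts.1 (h₁.wf hi))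
    have hmem : MPred.st (ρ₁.state 0) ∈ iota ρ₁ t := ⟨0, hi, TIvl.mem_iff_cuts.2 ht, rfl⟩
    rw [hι] at hmem
    obtain ⟨j, hj, htj, hs⟩ := hmem
    rcases Nat.eq_zero_or_pos j with rfl | hpos
    · exact hs.symm
    · rw [h₁.ivl_eq h₂ hι hi, ← TIvl.mem_iff_cuts] at ht
      exact absurd htj (h₂.not_mem_of_mem_of_lt hpos hj ht)

theorem IsExec.eq_of_iota_eq (h₁ : ρ₁.IsExec toR A) (h₂ : ρ₂.IsExec toR A)
    (hι : iota ρ₁ = iota ρ₂) : ρ₁ = ρ₂ := by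
  have hn := h₁.n_eq h₂ hι
  have hs := fun i hi => h₁.state_eq h₂ hι (i := i) hi
  have hI := fun i hi => h₁.ivl_eq h₂ hι (i := i) hi
  have hg := fun i hi => congrArg (fun e => e.2.2.1) (h₁.edge_eq h₂ hι (i := i) hi)
  have hr := fun i hi => congrArg (fun e => e.2.2.2) (h₁.edge_eq h₂ hι (i := i) hi)
  obtain ⟨-, hI₁, hg₁, hr₁, -⟩ := h₁
  obtain ⟨-, hI₂, hg₂, hr₂, -⟩ := h₂
  obtain ⟨s₁, I₁, g₁, r₁⟩ := ρ₁
  obtain ⟨s₂, I₂, g₂, r₂⟩ := ρ₂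
  simp only [n, state, ivl, edge, guard, reset] at *
  congr 1
  · exact list_ext_getD hn hs
  · exact list_ext_getD (by omega) fun i hi => hI i (by omega)
  · exact list_ext_getD (by omega) fun i hi => hg i (by omega)
  · exact list_ext_getD (by omega) fun i hi => hr i (by omega)

end Injective

end RawExec

/-- For every timed automaton `A`, the encoding `ι_A` is well defined and
injective from the accepting executions of `A` into the flows over `MP = V ∪ T ∪ R`:
every `ι_A(ρ)` is finitely variable on the time domain `ℝ≥0`, and distinct accepting
executions are mapped to distinct flows. -/
theorem iota_wellDefined_and_injective (A : TA ℕ) :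
    (∀ ρ : RawExec ℕ, ρ.IsAccExec natR A → FinVar (Set.Ici (0 : ℝ)) (iota ρ)) ∧
    (∀ ρ₁ ρ₂ : RawExec ℕ, ρ₁.IsAccExec natR A → ρ₂.IsAccExec natR A →
      ρ₁ ≠ ρ₂ → iota ρ₁ ≠ iota ρ₂) := by
  exact ⟨fun ρ _ => ρ.finVar_iota _, fun _ _ h₁ h₂ hne hι => hne (h₁.1.eq_of_iota_eq h₂.1 hι)⟩

end HyTime
end

section
/- Fix N > 0, a timed automaton A, and an HCMTL* formula φ whose free path variables are π_1,…,π_m. Let MP_1,…,MP_m be pairwise disjoint indexed copies of V ∪ T ∪ R and MP = MP_1 ∪ ⋯ ∪ MP_m, and for a path environment Π : {π_1,…,π_m} → Exec_N(A) define the flow f_Π : [0,N) → 𝒫(MP) by f_Π(t) = ∪_{i=1}^m ι_A(Π(π_i))(t), with the predicates arising from Π(π_i) placed in the copy MP_i. Then there exist m+1 MSO(<,+1) formulas ⟨φ⟩_0(x), ⟨φ⟩_1(x), …, ⟨φ⟩_m(x) over MP, each with a single free first-order variable x, such that for every t ∈ [0,N) and every such path environment Π: (1) for each i ∈ {1,…,m},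 Π, t, π_i ⊨^N_A φ if and only if f_Π ⊨ ⟨φ⟩_i(t); and (2) Π, 0, ε ⊨^N_A φ if and only if f_Π ⊨ ⟨φ⟩_0(0). -/
namespace HyTime

/-! ### Cuts of the time line -/

/-- Cuts of the real line: `(t, false)` lies just before `t` and `(t, true)` just after `t`. -/
abbrev Cut := ℝ ×ₗ Bool

namespace Cut

/-- The cut at time `t`, just before `t` (`b = false`) or just after `t` (`b = true`). -/
def at' (t : ℝ) (b : Bool) : Cut := toLex (t, b)

/-- The time of a cut. -/
def time (c : Cut) : ℝ := (ofLex c).1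

/-- The side of a cut. -/
def side (c : Cut) : Bool := (ofLex c).2

@[simp] lemma time_at (t : ℝ) (b : Bool) : time (at' t b) = t := rfl
@[simp] lemma at_eta (c : Cut) : at' (time c) (side c) = c := rfl

lemma at_lt_at {s t : ℝ} {a b : Bool} :
    at' s a < at' t b ↔ s < t ∨ (s = t ∧ a = false ∧ b = true) := by
  unfold at'
  rw [Prod.Lex.toLex_lt_toLex]
  cases a <;> cases b <;> simp

lemma at_inj {s t : ℝ} {a b : Bool} : at' s a = at' t b ↔ s = t ∧ a = b := by
  unfold at'
  rw [EmbeddingLike.apply_eq_iff_eq, Prod.mk.injEq]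

lemma at_le_at {s t : ℝ} {a b : Bool} :
    at' s a ≤ at' t b ↔ s < t ∨ (s = t ∧ (a = true → b = true)) := by
  unfold at'
  rw [Prod.Lex.toLex_le_toLex]
  cases a <;> cases b <;> simp

lemma eq_at (c : Cut) : ∃ t b, c = at' t b := ⟨time c, side c, rfl⟩

lemma le_false_iff {c : Cut} {t : ℝ} : c ≤ at' t false ↔ c < at' t true := by
  obtain ⟨s, a, rfl⟩ := eq_at c
  rw [at_lt_at, at_le_at]
  cases a <;> simp

lemma true_le_iff {c : Cut} {t : ℝ} : at' t true ≤ c ↔ at' t false < c := by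
  rw [← not_lt, ← le_false_iff, not_le]

lemma time_mono {c d : Cut} (h : c ≤ d) : time c ≤ time d := by
  obtain ⟨s, a, rfl⟩ := eq_at c
  obtain ⟨t, b, rfl⟩ := eq_at d
  rw [at_le_at] at h
  rcases h with h | h
  · exact h.le
  · exact h.1.le

lemma lt_of_time_lt {c d : Cut} (h : time c < time d) : c < d := by
  obtain ⟨s, a, rfl⟩ := eq_at c
  obtain ⟨t, b, rfl⟩ := eq_at d
  exact at_lt_at.2 (Or.inl h)

/-- Between two distinct cuts there is a point of time. -/
lemma exists_point {c d : Cut} (h : c < d) : ∃ t, c ≤ at' t false ∧ at' t true ≤ d := by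
  obtain ⟨s, a, rfl⟩ := eq_at c
  obtain ⟨t, b, rfl⟩ := eq_at d
  rw [at_lt_at] at h
  rcases h with h | ⟨rfl, rfl, rfl⟩
  · refine ⟨(s + t) / 2, ?_, ?_⟩ <;> rw [at_le_at] <;> left <;> linarith
  · exact ⟨s, le_rfl, le_rfl⟩

end Cut

open Cut

namespace TIvl

lemma mem_iff_cut (t : ℝ) (I : TIvl) :
    Mem t I ↔ at' I.lo (!I.loC) ≤ at' t false ∧ at' t true ≤ at' I.hi I.hiC := by
  unfold Mem
  rw [at_le_at, at_le_at]
  cases I.loC <;> cases I.hiC <;> simp [le_iff_lt_or_eq]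

lemma wf_iff_cut (I : TIvl) : I.WF ↔ at' I.lo (!I.loC) < at' I.hi I.hiC := by
  unfold WF
  rw [at_lt_at]
  simp

lemma consecutive_iff_cut (I J : TIvl) :
    I.Consecutive J ↔ at' I.hi I.hiC = at' J.lo (!J.loC) := by
  unfold Consecutive
  rw [at_inj]

end TIvl

namespace RawExec

/-- The `i`-th boundary of an execution: `ρ.bnd i` and `ρ.bnd (i+1)` delimit `ρ.ivl i`. -/
def bnd (ρ : RawExec ℕ) : ℕ → Cut
  | 0 => at' 0 false
  | i + 1 => at' (ρ.ivl i).hi (ρ.ivl i).hiC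

/-- The structural part of being an execution of `A` bounded by `N`, in terms of cuts. -/
structure Shape (A : TA ℕ) (N : ℝ) (ρ : RawExec ℕ) : Prop where
  pos : 0 < ρ.n
  ivls_length : ρ.ivls.length = ρ.n
  guards_length : ρ.guards.length = ρ.n - 1
  resets_length : ρ.resets.length = ρ.n - 1
  low : ∀ i, i < ρ.n → at' (ρ.ivl i).lo (!(ρ.ivl i).loC) = ρ.bnd i
  strict : ∀ i, i < ρ.n → ρ.bnd i < ρ.bnd (i + 1)
  last : ρ.bnd ρ.n ≤ at' N false
  edges : ∀ i, i + 1 < ρ.n → ρ.edge i ∈ A.edges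
  init : ρ.state 0 ∈ A.init

/-- The clock conditions of an execution. -/
def Clocks (A : TA ℕ) (ρ : RawExec ℕ) : Prop :=
  (∀ i, i < ρ.n → ∀ x ∈ A.clocks, ∀ t : ℝ, TIvl.Mem t (ρ.ivl i) →
    ClkC.holdsOpt natR (ρ.mu i x + t - (ρ.ivl i).lo) (A.betaOf (ρ.state i) x)) ∧
  (∀ i, i + 1 < ρ.n → ∀ q ∈ ρ.guard i,
    ClkC.holds natR (ρ.mu i q.1 + (ρ.ivl i).hi - (ρ.ivl i).lo) q.2)

namespace Shape
variable {A : TA ℕ} {N : ℝ} {ρ : RawExec ℕ}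

lemma mem_iff (h : Shape A N ρ) {i : ℕ} (hi : i < ρ.n) (t : ℝ) :
    TIvl.Mem t (ρ.ivl i) ↔ ρ.bnd i ≤ at' t false ∧ at' t true ≤ ρ.bnd (i + 1) := by
  rw [TIvl.mem_iff_cut, h.low i hi]
  rfl

lemma lo_eq (h : Shape A N ρ) {i : ℕ} (hi : i < ρ.n) : (ρ.ivl i).lo = (ρ.bnd i).time := by
  rw [← h.low i hi, time_at]

lemma hi_eq (i : ℕ) : (ρ.ivl i).hi = (ρ.bnd (i + 1)).time := rfl

lemma bnd_lt (h : Shape A N ρ) {i j : ℕ} (hij : i < j) (hj : j ≤ ρ.n) : ρ.bnd i < ρ.bnd j := by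
  induction j, hij using Nat.le_induction with
  | base => exact h.strict i hj
  | succ k hk ih => exact (ih (by omega)).trans (h.strict k hj)

lemma bnd_le (h : Shape A N ρ) {i j : ℕ} (hij : i ≤ j) (hj : j ≤ ρ.n) : ρ.bnd i ≤ ρ.bnd j := by
  rcases hij.eq_or_lt with rfl | hij
  · exact le_rfl
  · exact (h.bnd_lt hij hj).le

lemma lt_of_bnd_lt (h : Shape A N ρ) {i j : ℕ} (hi : i ≤ ρ.n) (hb : ρ.bnd i < ρ.bnd j) :
    i < j := by
  by_contra! hc
  exact absurd hb (h.bnd_le hc hi).not_gt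

lemma eq_of_bnd_eq (h : Shape A N ρ) {i j : ℕ} (hi : i ≤ ρ.n) (hj : j ≤ ρ.n)
    (hb : ρ.bnd i = ρ.bnd j) : i = j := by
  rcases lt_trichotomy i j with hl | rfl | hl
  · exact absurd hb (h.bnd_lt hl hj).ne
  · rfl
  · exact absurd hb (ne_of_gt (h.bnd_lt hl hi))

/-- The index of the interval containing a given point is unique. -/
lemma index_unique (h : Shape A N ρ) {i j : ℕ} {t : ℝ} (hi : i < ρ.n) (hj : j < ρ.n)
    (hti : TIvl.Mem t (ρ.ivl i)) (htj : TIvl.Mem t (ρ.ivl j)) : i = j := by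
  rw [h.mem_iff hi] at hti
  rw [h.mem_iff hj] at htj
  have h1 : i < j + 1 :=
    h.lt_of_bnd_lt hi.le ((le_false_iff.1 hti.1).trans_le htj.2)
  have h2 : j < i + 1 :=
    h.lt_of_bnd_lt hj.le ((le_false_iff.1 htj.1).trans_le hti.2)
  omega

lemma time_nonneg (h : Shape A N ρ) {i : ℕ} (hi : i ≤ ρ.n) : 0 ≤ (ρ.bnd i).time :=
  time_mono (h.bnd_le (Nat.zero_le i) hi)

lemma time_le (h : Shape A N ρ) {i : ℕ} (hi : i ≤ ρ.n) : (ρ.bnd i).time ≤ N :=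
  time_mono ((h.bnd_le hi le_rfl).trans h.last)

lemma time_lt (h : Shape A N ρ) {i : ℕ} (hi : i < ρ.n) : (ρ.bnd i).time < N := by
  have h1 := (h.bnd_lt hi le_rfl).trans_le h.last
  obtain ⟨t, b, hc⟩ := eq_at (ρ.bnd i)
  rw [hc, at_lt_at] at h1
  rw [hc]
  simpa using h1

lemma nonneg_of_mem (h : Shape A N ρ) {i : ℕ} {t : ℝ} (hi : i < ρ.n)
    (ht : TIvl.Mem t (ρ.ivl i)) : 0 ≤ t :=
  (h.time_nonneg hi.le).trans (time_mono ((h.mem_iff hi t).1 ht).1)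

lemma lt_of_mem (h : Shape A N ρ) {i : ℕ} {t : ℝ} (hi : i < ρ.n)
    (ht : TIvl.Mem t (ρ.ivl i)) : t < N := by
  have := (((h.mem_iff hi t).1 ht).2.trans (h.bnd_le hi le_rfl)).trans h.last
  rw [at_le_at] at this
  simpa using this

/-- Every cut strictly after the start and not after the end is in a unique slot. -/
lemma exists_slot {d : Cut} (h0 : at' 0 false < d) (h1 : d ≤ ρ.bnd ρ.n) :
    ∃ i, i < ρ.n ∧ ρ.bnd i < d ∧ d ≤ ρ.bnd (i + 1) := by
  by_contra! hc
  have : ∀ i, i ≤ ρ.n → ρ.bnd i < d := by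
    intro i
    induction i with
    | zero => intro _; exact h0
    | succ k ih => intro hk; exact hc k hk (ih (by omega))
  exact absurd h1 (this _ le_rfl).not_ge

lemma memLen_iff (h : Shape A N ρ) {t : ℝ} (ht : 0 ≤ t) :
    MemLen t ρ ↔ at' t true ≤ ρ.bnd ρ.n := by
  constructor
  · rintro ⟨i, hi, hm⟩
    exact ((h.mem_iff hi t).1 hm).2.trans (h.bnd_le hi le_rfl)
  · intro hle
    obtain ⟨i, hi, h1, h2⟩ := exists_slot (ρ := ρ) (d := at' t true)
      (by rw [at_lt_at]; rcases ht.eq_or_lt with h0 | h0 <;> simp [h0]) hle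
    exact ⟨i, hi, (h.mem_iff hi t).2 ⟨le_false_iff.2 h1, h2⟩⟩

end Shape

lemma accExec_iff (A : TA ℕ) (N : ℝ) (ρ : RawExec ℕ) :
    (ρ.IsAccExec natR A ∧ ρ.BoundedBy N) ↔
      Shape A N ρ ∧ ρ.Clocks A ∧ ρ.state (ρ.n - 1) ∈ A.final := by
  constructor
  · rintro ⟨⟨⟨h0, h1, h2, h3, h4, h5, h6, h7, h8, h9, h10, h11⟩, hf⟩, hb⟩
    refine ⟨?_, ⟨h10, h11⟩, hf⟩
    have hlow : ∀ i, i < ρ.n → at' (ρ.ivl i).lo (!(ρ.ivl i).loC) = ρ.bnd i := by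
      intro i hi
      cases i with
      | zero => rw [h4, h5]; rfl
      | succ k => exact ((TIvl.consecutive_iff_cut _ _).1 (h7 k hi)).symm
    have hstrict : ∀ i, i < ρ.n → ρ.bnd i < ρ.bnd (i + 1) := by
      intro i hi
      rw [← hlow i hi]
      exact (TIvl.wf_iff_cut _).1 (h6 i hi)
    refine ⟨h0, h1, h2, h3, hlow, hstrict, ?_, h9, h8⟩
    obtain ⟨k, hk⟩ : ∃ k, ρ.n = k + 1 := ⟨ρ.n - 1, by omega⟩
    rw [hk]
    by_contra! hc
    rw [← true_le_iff] at hc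
    have hmem : ∀ t, ρ.bnd k ≤ at' t false ∧ at' t true ≤ ρ.bnd (k + 1) →
        TIvl.Mem t (ρ.ivl k) := by
      intro t ht
      rw [TIvl.mem_iff_cut, hlow k (by omega)]
      exact ht
    by_cases hd : ρ.bnd k ≤ at' N false
    · exact hb N le_rfl ⟨k, by omega, hmem N ⟨hd, hc⟩⟩
    · obtain ⟨t, ht⟩ := exists_point (hstrict k (by omega))
      refine hb t ?_ ⟨k, by omega, hmem t ht⟩
      have := (not_le.1 hd).trans_le ht.1
      rw [at_lt_at] at this
      simp at this
      exact this.le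
  · rintro ⟨h, ⟨hc1, hc2⟩, hf⟩
    refine ⟨⟨⟨h.pos, h.ivls_length, h.guards_length, h.resets_length, ?_, ?_, ?_, ?_, h.init,
      h.edges, hc1, hc2⟩, hf⟩, ?_⟩
    · have := h.low 0 h.pos
      exact (at_inj.1 this).1
    · have := h.low 0 h.pos
      simpa using (at_inj.1 this).2
    · intro i hi
      rw [TIvl.wf_iff_cut, h.low i hi]
      exact h.strict i hi
    · intro i hi
      rw [TIvl.consecutive_iff_cut, h.low (i + 1) hi]
      rfl
    · rintro t ht ⟨i, hi, hm⟩
      exact absurd (h.lt_of_mem hi hm) ht.not_gt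

end RawExec

/-! ### The encoding of executions in terms of cuts -/

/-- The marker of the edge `e` at the cut on side `b` of the current time. -/
def evm (e : IEdge ℕ) (b : Bool) : MPred ℕ := if b then .tplus e else .tminus e

namespace RawExec.Shape
variable {A : TA ℕ} {N : ℝ} {ρ : RawExec ℕ}

lemma st_mem_iota (h : Shape A N ρ) (v : ℕ) (t : ℝ) :
    MPred.st v ∈ iota ρ t ↔
      ∃ i, i < ρ.n ∧ (ρ.bnd i ≤ at' t false ∧ at' t true ≤ ρ.bnd (i + 1)) ∧ ρ.state i = v := by
  change (∃ i, _) ↔ _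
  refine exists_congr fun i => and_congr_right fun hi => ?_
  rw [h.mem_iff hi]

lemma evm_mem_iota (h : Shape A N ρ) (e : IEdge ℕ) (b : Bool) (t : ℝ) :
    evm e b ∈ iota ρ t ↔ ∃ i, i + 1 < ρ.n ∧ ρ.edge i = e ∧ ρ.bnd (i + 1) = at' t b := by
  cases b
  · change (∃ i, _) ↔ _
    refine exists_congr fun i => and_congr_right fun hi => and_congr_right fun _ => ?_
    rw [h.mem_iff hi, h.lo_eq hi]
    constructor
    · rintro ⟨rfl, h1, -⟩
      rw [← at_eta (ρ.bnd (i + 1)), at_le_at] at h1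
      rw [← at_eta (ρ.bnd (i + 1)), at_inj]
      simpa using h1
    · intro hb
      have := h.strict (i + 1) hi
      rw [hb] at this ⊢
      exact ⟨rfl, le_rfl, true_le_iff.2 this⟩
  · change (∃ i, _) ↔ _
    refine exists_congr fun i => and_congr_right fun hi => and_congr_right fun _ => ?_
    have hi' : i < ρ.n := by omega
    rw [h.mem_iff hi', hi_eq]
    constructor
    · rintro ⟨rfl, -, h1⟩
      rw [← at_eta (ρ.bnd (i + 1)), at_le_at] at h1
      rw [← at_eta (ρ.bnd (i + 1)), at_inj]
      simpa using h1
    · intro hb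
      have := h.strict i hi'
      rw [hb] at this ⊢
      exact ⟨rfl, le_false_iff.2 this, le_rfl⟩

end RawExec.Shape

end HyTime

namespace HyTime
open Cut Set

/-! ### Flows that encode executions -/

/-- The states that may occur in an execution. -/
def TA.visited (A : TA ℕ) : List ℕ :=
  A.init ++ A.edges.map (fun e => e.1) ++ A.edges.map (fun e => e.2.1)

lemma TA.init_visited {A : TA ℕ} {v : ℕ} (h : v ∈ A.init) : v ∈ A.visited := by
  simp [TA.visited, h]

lemma TA.src_visited {A : TA ℕ} {e : IEdge ℕ} (h : e ∈ A.edges) : e.1 ∈ A.visited := by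
  simp only [TA.visited, List.mem_append, List.mem_map]
  exact Or.inl (Or.inr ⟨e, h, rfl⟩)

lemma TA.dst_visited {A : TA ℕ} {e : IEdge ℕ} (h : e ∈ A.edges) : e.2.1 ∈ A.visited := by
  simp only [TA.visited, List.mem_append, List.mem_map]
  exact Or.inr ⟨e, h, rfl⟩

/-- The flow `w` agrees with the encoding of `ρ` on states and edge markers. -/
def Agrees (A : TA ℕ) (N : ℝ) (w : ℝ → Set (MPred ℕ)) (ρ : RawExec ℕ) : Prop :=
  ∀ t ∈ Ico (0 : ℝ) N, (∀ v ∈ A.visited, (.st v ∈ w t ↔ .st v ∈ iota ρ t)) ∧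
    ∀ e ∈ A.edges, ∀ b, (evm e b ∈ w t ↔ evm e b ∈ iota ρ t)

/-- The encoded execution is still running at time `t`. -/
def Alive (A : TA ℕ) (w : ℝ → Set (MPred ℕ)) (t : ℝ) : Prop := ∃ v ∈ A.visited, .st v ∈ w t

/-- The clock `x` is set to zero at time `s`, before the cut `d`. -/
def IsReset (A : TA ℕ) (N : ℝ) (w : ℝ → Set (MPred ℕ)) (x : ℕ) (d : Cut) (s : ℝ) : Prop :=
  (∀ u ∈ Ico (0 : ℝ) N, ¬ u < s) ∨
    ∃ b, at' s b < d ∧ ∃ e ∈ A.edges, x ∈ e.2.2.2 ∧ evm e b ∈ w s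

/-- The value of the clock `x` at the cut `d` satisfies `c`. -/
def ClkOK (A : TA ℕ) (N : ℝ) (w : ℝ → Set (MPred ℕ)) (x : ℕ) (d : Cut) (c : ClkC ℕ) : Prop :=
  ∀ s ∈ Ico (0 : ℝ) N, IsReset A N w x d s →
    (∀ s' ∈ Ico (0 : ℝ) N, s < s' → ¬ IsReset A N w x d s') → c.holds natR (d.time - s)

/-- Local conditions characterizing the flows that encode accepting executions. -/
structure FlowOK (A : TA ℕ) (N : ℝ) (w : ℝ → Set (MPred ℕ)) : Prop where
  st_unique : ∀ t ∈ Ico (0 : ℝ) N, ∀ v ∈ A.visited, ∀ v' ∈ A.visited,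
    .st v ∈ w t → .st v' ∈ w t → v = v'
  ev_unique : ∀ t ∈ Ico (0 : ℝ) N, ∀ b, ∀ e ∈ A.edges, ∀ e' ∈ A.edges,
    evm e b ∈ w t → evm e' b ∈ w t → e = e'
  alive_down : ∀ s ∈ Ico (0 : ℝ) N, ∀ t ∈ Ico (0 : ℝ) N, s < t → Alive A w t → Alive A w s
  init : ∀ t ∈ Ico (0 : ℝ) N, (∀ u ∈ Ico (0 : ℝ) N, ¬ u < t) → ∃ v ∈ A.init, .st v ∈ w t
  cont : ∀ s ∈ Ico (0 : ℝ) N, ∀ t ∈ Ico (0 : ℝ) N, s < t → Alive A w t →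
    (∀ r ∈ Ico (0 : ℝ) N, ∀ b, at' s false < at' r b → at' r b < at' t true →
      ∀ e ∈ A.edges, evm e b ∉ w r) →
    ∀ v ∈ A.visited, .st v ∈ w s → .st v ∈ w t
  minus : ∀ t ∈ Ico (0 : ℝ) N, ∀ e ∈ A.edges, evm e false ∈ w t →
    .st e.2.1 ∈ w t ∧ ∃ u ∈ Ico (0 : ℝ) N, u < t ∧ ∀ r ∈ Ico (0 : ℝ) N, u < r → r < t →
      .st e.1 ∈ w r ∧ ∀ b, ∀ e' ∈ A.edges, evm e' b ∉ w r
  plus : ∀ t ∈ Ico (0 : ℝ) N, ∀ e ∈ A.edges, evm e true ∈ w t →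
    .st e.1 ∈ w t ∧ ∃ u ∈ Ico (0 : ℝ) N, t < u ∧ ∀ r ∈ Ico (0 : ℝ) N, t < r → r < u →
      .st e.2.1 ∈ w r ∧ ∀ b, ∀ e' ∈ A.edges, evm e' b ∉ w r
  final : ∃ u ∈ Ico (0 : ℝ) N, Alive A w u ∧ ∀ r ∈ Ico (0 : ℝ) N, ¬ r < u →
    ∀ v ∈ A.visited, v ∉ A.final → .st v ∉ w r
  beta : ∀ t ∈ Ico (0 : ℝ) N, ∀ v ∈ A.visited, .st v ∈ w t → ∀ x ∈ A.clocks,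
    ∀ c ∈ A.betaOf v x, ClkOK A N w x (at' t true) c
  guard : ∀ t ∈ Ico (0 : ℝ) N, ∀ b, ∀ e ∈ A.edges, evm e b ∈ w t →
    ∀ q ∈ e.2.2.1, ClkOK A N w q.1 (at' t b) q.2

namespace RawExec

/-- The time of the last reset of `x` before entering the `i`-th interval. -/
def lastReset (ρ : RawExec ℕ) (x : ℕ) : ℕ → ℝ
  | 0 => 0
  | i + 1 => if x ∈ ρ.reset i then (ρ.bnd (i + 1)).time else ρ.lastReset x i

lemma lastReset_mem (ρ : RawExec ℕ) (x i : ℕ) : ρ.lastReset x i = 0 ∨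
    ∃ j, j < i ∧ x ∈ ρ.reset j ∧ (ρ.bnd (j + 1)).time = ρ.lastReset x i := by
  induction i with
  | zero => exact Or.inl rfl
  | succ k ih =>
    unfold lastReset
    split_ifs with hx
    · exact Or.inr ⟨k, by omega, hx, rfl⟩
    · rcases ih with ih | ⟨j, hj, ih⟩
      · exact Or.inl ih
      · exact Or.inr ⟨j, by omega, ih⟩

namespace Shape
variable {A : TA ℕ} {N : ℝ} {ρ : RawExec ℕ} {w : ℝ → Set (MPred ℕ)}

lemma lastReset_le (h : Shape A N ρ) (x : ℕ) {i : ℕ} (hi : i ≤ ρ.n) :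
    ρ.lastReset x i ≤ (ρ.bnd i).time := by
  rcases ρ.lastReset_mem x i with h0 | ⟨j, hj, -, h0⟩
  · rw [h0]; exact h.time_nonneg hi
  · rw [← h0]; exact time_mono (h.bnd_le (by omega) hi)

lemma le_lastReset (h : Shape A N ρ) {x i j : ℕ} (hi : i ≤ ρ.n) (hj : j < i)
    (hx : x ∈ ρ.reset j) : (ρ.bnd (j + 1)).time ≤ ρ.lastReset x i := by
  induction i with
  | zero => omega
  | succ k ih =>
    unfold lastReset
    split_ifs with hk
    · exact time_mono (h.bnd_le (by omega) hi)
    · have : j ≠ k := by rintro rfl; exact hk hx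
      exact ih (by omega) (by omega)

lemma lastReset_nonneg (h : Shape A N ρ) (x : ℕ) {i : ℕ} (hi : i ≤ ρ.n) :
    0 ≤ ρ.lastReset x i := by
  rcases ρ.lastReset_mem x i with h0 | ⟨j, hj, -, h0⟩
  · rw [h0]
  · rw [← h0]; exact h.time_nonneg (by omega)

lemma mu_eq (h : Shape A N ρ) (x : ℕ) {i : ℕ} (hi : i < ρ.n) :
    ρ.mu i x = (ρ.ivl i).lo - ρ.lastReset x i := by
  rw [h.lo_eq hi]
  induction i with
  | zero => simp [mu, lastReset, bnd]
  | succ k ih =>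
    unfold mu lastReset
    split_ifs with hx
    · simp
    · rw [ih (by omega), h.lo_eq (by omega), hi_eq]
      ring

lemma state_visited (h : Shape A N ρ) {i : ℕ} (hi : i < ρ.n) : ρ.state i ∈ A.visited := by
  cases i with
  | zero => exact TA.init_visited h.init
  | succ k => exact TA.dst_visited (h.edges k hi)

lemma isReset_iff (h : Shape A N ρ) (hw : Agrees A N w ρ) (x : ℕ) {i : ℕ} (hi : i < ρ.n)
    {d : Cut} (h1 : ρ.bnd i < d) (h2 : d ≤ ρ.bnd (i + 1)) {s : ℝ} (hs : s ∈ Ico 0 N) :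
    IsReset A N w x d s ↔
      s = 0 ∨ ∃ j, j < i ∧ x ∈ ρ.reset j ∧ (ρ.bnd (j + 1)).time = s := by
  unfold IsReset
  apply or_congr
  · constructor
    · intro hu
      have := hu 0 ⟨le_rfl, hs.1.trans_lt hs.2⟩
      exact le_antisymm (not_lt.1 this) hs.1
    · rintro rfl u hu
      exact hu.1.not_gt
  · constructor
    · rintro ⟨b, hb, e, he, hx, hew⟩
      rw [(hw s hs).2 e he, h.evm_mem_iota] at hew
      obtain ⟨j, hj, rfl, hc⟩ := hew
      refine ⟨j, ?_, hx, by rw [hc, time_at]⟩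
      have := h.lt_of_bnd_lt (i := j + 1) (j := i + 1) (by omega) (by
        rw [hc]; exact hb.trans_le h2)
      omega
    · rintro ⟨j, hj, hx, rfl⟩
      refine ⟨(ρ.bnd (j + 1)).side, ?_, ρ.edge j, h.edges j (by omega), hx, ?_⟩
      · rw [at_eta]
        exact (h.bnd_le (by omega) hi.le).trans_lt h1
      · rw [(hw _ hs).2 _ (h.edges j (by omega)), h.evm_mem_iota]
        exact ⟨j, by omega, rfl, rfl⟩

lemma clkOK_iff (h : Shape A N ρ) (hw : Agrees A N w ρ) (x : ℕ) {i : ℕ} (hi : i < ρ.n)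
    {d : Cut} (h1 : ρ.bnd i < d) (h2 : d ≤ ρ.bnd (i + 1)) (c : ClkC ℕ) :
    ClkOK A N w x d c ↔ c.holds natR (ρ.mu i x + d.time - (ρ.ivl i).lo) := by
  have hD : ρ.lastReset x i ∈ Ico 0 N :=
    ⟨h.lastReset_nonneg x hi.le, (h.lastReset_le x hi.le).trans_lt (h.time_lt hi)⟩
  have hmem := ρ.lastReset_mem x i
  have hv : ρ.mu i x + d.time - (ρ.ivl i).lo = d.time - ρ.lastReset x i := by
    rw [h.mu_eq x hi]; ring
  rw [hv]
  constructor
  · intro hc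
    refine hc _ hD ((h.isReset_iff hw x hi h1 h2 hD).2 hmem) fun s' hs' hlt hr => ?_
    rcases (h.isReset_iff hw x hi h1 h2 hs').1 hr with rfl | ⟨j, hj, hx, rfl⟩
    · exact absurd hlt hD.1.not_gt
    · exact absurd hlt (h.le_lastReset hi.le hj hx).not_gt
  · intro hc s hs hr hlast
    have : s = ρ.lastReset x i := by
      apply le_antisymm
      · rcases (h.isReset_iff hw x hi h1 h2 hs).1 hr with rfl | ⟨j, hj, hx, rfl⟩
        · exact hD.1
        · exact h.le_lastReset hi.le hj hx
      · by_contra! hlt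
        exact hlast _ hD hlt ((h.isReset_iff hw x hi h1 h2 hD).2 hmem)
    rwa [this]

lemma st_mem_iff (hw : Agrees A N w ρ) {t : ℝ} (ht : t ∈ Ico 0 N) {v : ℕ}
    (hv : v ∈ A.visited) : MPred.st v ∈ w t ↔
      ∃ i, i < ρ.n ∧ TIvl.Mem t (ρ.ivl i) ∧ ρ.state i = v := by
  rw [(hw t ht).1 v hv]
  rfl

lemma ev_mem_iff (h : Shape A N ρ) (hw : Agrees A N w ρ) {t : ℝ} (ht : t ∈ Ico 0 N)
    {e : IEdge ℕ} {b : Bool} (he : e ∈ A.edges) : evm e b ∈ w t ↔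
      ∃ i, i + 1 < ρ.n ∧ ρ.edge i = e ∧ ρ.bnd (i + 1) = at' t b := by
  rw [(hw t ht).2 e he b, h.evm_mem_iota]

lemma st_of_mem (h : Shape A N ρ) (hw : Agrees A N w ρ) {t : ℝ} {i : ℕ} (hi : i < ρ.n)
    (ht : TIvl.Mem t (ρ.ivl i)) : MPred.st (ρ.state i) ∈ w t :=
  (st_mem_iff hw ⟨h.nonneg_of_mem hi ht, h.lt_of_mem hi ht⟩ (h.state_visited hi)).2
    ⟨i, hi, ht, rfl⟩

lemma alive_iff (h : Shape A N ρ) (hw : Agrees A N w ρ) {t : ℝ} (ht : t ∈ Ico 0 N) :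
    Alive A w t ↔ MemLen t ρ := by
  constructor
  · rintro ⟨v, hv, hvt⟩
    obtain ⟨i, hi, hm, -⟩ := (st_mem_iff hw ht hv).1 hvt
    exact ⟨i, hi, hm⟩
  · rintro ⟨i, hi, hm⟩
    exact ⟨_, h.state_visited hi, h.st_of_mem hw hi hm⟩

lemma clocks_and_final (h : Shape A N ρ) (hw : Agrees A N w ρ) (hf : FlowOK A N w) :
    ρ.Clocks A ∧ ρ.state (ρ.n - 1) ∈ A.final := by
  refine ⟨⟨?_, ?_⟩, ?_⟩
  · intro i hi x hx t ht
    have hm := (h.mem_iff hi t).1 ht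
    cases hb : A.betaOf (ρ.state i) x with
    | none => trivial
    | some c =>
      have := hf.beta t ⟨h.nonneg_of_mem hi ht, h.lt_of_mem hi ht⟩ _ (h.state_visited hi)
        (h.st_of_mem hw hi ht) x hx c hb
      exact (h.clkOK_iff hw x hi (le_false_iff.1 hm.1) hm.2 c).1 this
  · intro i hi q hq
    have hD : (ρ.bnd (i + 1)).time ∈ Ico 0 N := ⟨h.time_nonneg hi.le, h.time_lt hi⟩
    have := hf.guard _ hD (ρ.bnd (i + 1)).side (ρ.edge i) (h.edges i hi)
      ((h.ev_mem_iff hw hD (h.edges i hi)).2 ⟨i, hi, rfl, rfl⟩) q hq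
    rw [at_eta] at this
    exact (h.clkOK_iff hw q.1 (by omega) (h.strict i (by omega)) le_rfl q.2).1 this
  · obtain ⟨u, hu, ha, hr⟩ := hf.final
    obtain ⟨j, hj, hm⟩ := (h.alive_iff hw hu).1 ha
    have hl : ρ.n - 1 < ρ.n := by have := h.pos; omega
    obtain ⟨r, hr1, hr2⟩ : ∃ r, TIvl.Mem r (ρ.ivl (ρ.n - 1)) ∧ ¬ r < u := by
      by_cases hjl : j = ρ.n - 1
      · subst hjl; exact ⟨u, hm, lt_irrefl u⟩
      · obtain ⟨r, hr⟩ := exists_point (h.strict _ hl)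
        refine ⟨r, (h.mem_iff hl r).2 hr, fun hlt => ?_⟩
        have h1 := ((h.mem_iff hj u).1 hm).2.trans
          ((h.bnd_le (by omega) hl.le).trans hr.1)
        rw [at_le_at] at h1
        simp at h1
        exact absurd h1 hlt.not_gt
    by_contra hnf
    exact hr r ⟨h.nonneg_of_mem hl hr1, h.lt_of_mem hl hr1⟩ hr2 _ (h.state_visited hl) hnf
      (h.st_of_mem hw hl hr1)

lemma flowOK (h : Shape A N ρ) (hw : Agrees A N w ρ) (hc : ρ.Clocks A)
    (hfin : ρ.state (ρ.n - 1) ∈ A.final) : FlowOK A N w where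
  st_unique := by
    intro t ht v hv v' hv' h1 h2
    obtain ⟨i, hi, hm, rfl⟩ := (st_mem_iff hw ht hv).1 h1
    obtain ⟨j, hj, hm', rfl⟩ := (st_mem_iff hw ht hv').1 h2
    rw [h.index_unique hi hj hm hm']
  ev_unique := by
    intro t ht b e he e' he' h1 h2
    obtain ⟨i, hi, rfl, hb⟩ := (h.ev_mem_iff hw ht he).1 h1
    obtain ⟨j, hj, rfl, hb'⟩ := (h.ev_mem_iff hw ht he').1 h2
    have := h.eq_of_bnd_eq (i := i + 1) (j := j + 1) (by omega) (by omega) (hb.trans hb'.symm)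
    rw [Nat.succ_injective this]
  alive_down := by
    intro s hs t ht hst ha
    rw [h.alive_iff hw ht, h.memLen_iff ht.1] at ha
    rw [h.alive_iff hw hs, h.memLen_iff hs.1]
    exact (at_lt_at.2 (Or.inl hst)).le.trans ha
  init := by
    intro t ht h0
    have ht0 : t = 0 := le_antisymm (not_lt.1 (h0 0 ⟨le_rfl, ht.1.trans_lt ht.2⟩)) ht.1
    refine ⟨_, h.init, h.st_of_mem hw h.pos ((h.mem_iff h.pos t).2 ⟨?_, ?_⟩)⟩
    · rw [ht0]; exact le_rfl
    · rw [ht0, true_le_iff]; exact h.strict 0 h.pos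
  cont := by
    intro s hs t ht hst ha hno v hv hvs
    obtain ⟨i, hi, hm, rfl⟩ := (st_mem_iff hw hs hv).1 hvs
    obtain ⟨j, hj, hm'⟩ := (h.alive_iff hw ht).1 ha
    have hi' := (h.mem_iff hi s).1 hm
    have hj' := (h.mem_iff hj t).1 hm'
    have hij : i < j + 1 := h.lt_of_bnd_lt hi.le
      ((hi'.1.trans_lt (at_lt_at.2 (Or.inl hst))).trans_le hj'.2)
    by_cases hij' : i = j
    · subst hij'; exact h.st_of_mem hw hi hm'
    · have hi1 : i + 1 < ρ.n := by omega
      have hD : (ρ.bnd (i + 1)).time ∈ Ico 0 N := ⟨h.time_nonneg hi1.le, h.time_lt hi1⟩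
      refine absurd ((h.ev_mem_iff hw hD (h.edges i hi1)).2 ⟨i, hi1, rfl, rfl⟩)
        (hno _ hD (ρ.bnd (i + 1)).side ?_ ?_ _ (h.edges i hi1))
      · rw [at_eta]; exact true_le_iff.1 hi'.2
      · rw [at_eta]
        exact le_false_iff.1 ((h.bnd_le (by omega) hj.le).trans hj'.1)
  minus := by
    intro t ht e he hev
    obtain ⟨i, hi, rfl, hb⟩ := (h.ev_mem_iff hw ht he).1 hev
    have hi' : i < ρ.n := by omega
    have h1 := h.strict (i + 1) hi
    have h0 := h.strict i hi'
    rw [hb] at h0 h1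
    refine ⟨h.st_of_mem hw hi ((h.mem_iff hi t).2 ⟨hb.le, true_le_iff.2 h1⟩),
      (ρ.bnd i).time, ⟨h.time_nonneg hi'.le, h.time_lt hi'⟩, ?_, ?_⟩
    · rw [← at_eta (ρ.bnd i), at_lt_at] at h0
      simpa using h0
    · intro r hr hr1 hr2
      have hc1 : ρ.bnd i < at' r false := lt_of_time_lt hr1
      have hc2 : at' r true < ρ.bnd (i + 1) := hb ▸ lt_of_time_lt hr2
      refine ⟨h.st_of_mem hw hi' ((h.mem_iff hi' r).2 ⟨hc1.le, hc2.le⟩), fun b e' he' hev' => ?_⟩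
      obtain ⟨j, hj, -, hb'⟩ := (h.ev_mem_iff hw hr he').1 hev'
      have hj1 : i < j + 1 := h.lt_of_bnd_lt hi'.le (hb' ▸ lt_of_time_lt hr1)
      have hj2 : j + 1 < i + 1 := h.lt_of_bnd_lt hj.le (by
        rw [hb', hb]; exact lt_of_time_lt hr2)
      omega
  plus := by
    intro t ht e he hev
    obtain ⟨i, hi, rfl, hb⟩ := (h.ev_mem_iff hw ht he).1 hev
    have hi' : i < ρ.n := by omega
    have h1 := h.strict (i + 1) hi
    have h0 := h.strict i hi'
    rw [hb] at h0 h1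
    have hlt : t < (ρ.bnd (i + 1 + 1)).time := by
      rw [← at_eta (ρ.bnd (i + 1 + 1)), at_lt_at] at h1
      simpa using h1
    have hN := h.time_le (i := i + 1 + 1) hi
    refine ⟨h.st_of_mem hw hi' ((h.mem_iff hi' t).2 ⟨le_false_iff.2 h0, hb.ge⟩),
      (t + (ρ.bnd (i + 1 + 1)).time) / 2, ⟨?_, ?_⟩, ?_, ?_⟩
    · have := ht.1; linarith
    · linarith
    · linarith
    · intro r hr hr1 hr2
      have hr3 : r < (ρ.bnd (i + 1 + 1)).time := by linarith
      have hc1 : ρ.bnd (i + 1) < at' r false := hb ▸ lt_of_time_lt hr1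
      have hc2 : at' r true < ρ.bnd (i + 1 + 1) := lt_of_time_lt hr3
      refine ⟨h.st_of_mem hw hi ((h.mem_iff hi r).2 ⟨hc1.le, hc2.le⟩), fun b e' he' hev' => ?_⟩
      obtain ⟨j, hj, -, hb'⟩ := (h.ev_mem_iff hw hr he').1 hev'
      have hj1 : i + 1 < j + 1 := h.lt_of_bnd_lt hi.le (by
        rw [hb', hb]; exact lt_of_time_lt hr1)
      have hj2 : j + 1 < i + 1 + 1 := h.lt_of_bnd_lt hj.le (by
        rw [hb']; exact lt_of_time_lt hr3)
      omega
  final := by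
    have hl : ρ.n - 1 < ρ.n := by have := h.pos; omega
    obtain ⟨u, hu⟩ := exists_point (h.strict _ hl)
    have hm := (h.mem_iff hl u).2 hu
    have hD : u ∈ Ico 0 N := ⟨h.nonneg_of_mem hl hm, h.lt_of_mem hl hm⟩
    refine ⟨u, hD, (h.alive_iff hw hD).2 ⟨_, hl, hm⟩, fun r hr hru v hv hvf hvr => ?_⟩
    obtain ⟨j, hj, hjm, rfl⟩ := (st_mem_iff hw hr hv).1 hvr
    have hj1 : ρ.n - 1 < j + 1 := h.lt_of_bnd_lt hl.le (by
      refine lt_of_lt_of_le ?_ ((h.mem_iff hj r).1 hjm).2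
      refine hu.1.trans_lt ?_
      rw [at_lt_at]
      rcases (not_lt.1 hru).lt_or_eq with h' | h'
      · exact Or.inl h'
      · exact Or.inr ⟨h', rfl, rfl⟩)
    have : j = ρ.n - 1 := by omega
    subst this
    exact hvf hfin
  beta := by
    intro t ht v hv hvt x hx c hb
    obtain ⟨i, hi, hm, rfl⟩ := (st_mem_iff hw ht hv).1 hvt
    have hm' := (h.mem_iff hi t).1 hm
    rw [h.clkOK_iff hw x hi (le_false_iff.1 hm'.1) hm'.2 c]
    have := hc.1 i hi x hx t hm
    rw [Option.mem_def.1 hb] at this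
    exact this
  guard := by
    intro t ht b e he hev q hq
    obtain ⟨i, hi, rfl, hb⟩ := (h.ev_mem_iff hw ht he).1 hev
    rw [← hb, h.clkOK_iff hw q.1 (by omega) (h.strict i (by omega)) le_rfl q.2]
    exact hc.2 i hi q hq

end Shape
end RawExec
end HyTime

namespace HyTime
open Cut Set

/-! ### Reconstructing an execution from a flow -/

namespace RawExec

/-- The execution with the given boundaries, states, guards and resets. -/
def ofCuts (n : ℕ) (c : ℕ → Cut) (st : ℕ → ℕ) (g : ℕ → List (ℕ × ClkC ℕ)) (r : ℕ → List ℕ) :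
    RawExec ℕ where
  states := (List.range n).map st
  ivls := (List.range n).map
    (fun i => ⟨(c i).time, (c (i + 1)).time, !(c i).side, (c (i + 1)).side⟩)
  guards := (List.range (n - 1)).map g
  resets := (List.range (n - 1)).map r

section ofCuts
variable {n : ℕ} {c : ℕ → Cut} {st : ℕ → ℕ} {g : ℕ → List (ℕ × ClkC ℕ)} {r : ℕ → List ℕ}

@[simp] lemma ofCuts_n : (ofCuts n c st g r).n = n := by simp [ofCuts, RawExec.n]

lemma getD_map_range {α : Type} (f : ℕ → α) (d : α) {i m : ℕ} (hi : i < m) :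
    ((List.range m).map f).getD i d = f i := by
  rw [List.getD_eq_getElem _ _ (by simpa using hi)]
  simp

lemma ofCuts_ivl {i : ℕ} (hi : i < n) : (ofCuts n c st g r).ivl i =
    ⟨(c i).time, (c (i + 1)).time, !(c i).side, (c (i + 1)).side⟩ := getD_map_range _ _ hi

lemma ofCuts_state {i : ℕ} (hi : i < n) : (ofCuts n c st g r).state i = st i :=
  getD_map_range _ _ hi

lemma ofCuts_edge {i : ℕ} (hi : i + 1 < n) :
    (ofCuts n c st g r).edge i = (st i, st (i + 1), g i, r i) := by
  unfold edge
  rw [ofCuts_state hi, ofCuts_state (by omega)]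
  congr 1
  congr 1
  have h1 : (ofCuts n c st g r).guard i = g i := getD_map_range _ _ (by omega)
  have h2 : (ofCuts n c st g r).reset i = r i := getD_map_range _ _ (by omega)
  rw [h1, h2]

lemma ofCuts_bnd (h0 : c 0 = at' 0 false) {i : ℕ} (hi : i ≤ n) :
    (ofCuts n c st g r).bnd i = c i := by
  cases i with
  | zero => exact h0.symm
  | succ k =>
    change at' ((ofCuts n c st g r).ivl k).hi ((ofCuts n c st g r).ivl k).hiC = _
    rw [ofCuts_ivl (by omega)]
    rfl

lemma ofCuts_shape {A : TA ℕ} {N : ℝ} (h0 : c 0 = at' 0 false) (hn : 0 < n)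
    (hc : ∀ i, i < n → c i < c (i + 1)) (hN : c n ≤ at' N false)
    (he : ∀ i, i + 1 < n → (st i, st (i + 1), g i, r i) ∈ A.edges) (hi : st 0 ∈ A.init) :
    Shape A N (ofCuts n c st g r) where
  pos := by simpa using hn
  ivls_length := by simp [ofCuts, RawExec.n]
  guards_length := by simp [ofCuts, RawExec.n]
  resets_length := by simp [ofCuts, RawExec.n]
  low i hi := by
    rw [ofCuts_n] at hi
    rw [ofCuts_ivl hi, ofCuts_bnd h0 hi.le]
    simp
  strict i hi := by
    rw [ofCuts_n] at hi
    rw [ofCuts_bnd h0 hi.le, ofCuts_bnd h0 hi]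
    exact hc i hi
  last := by
    rw [ofCuts_n, ofCuts_bnd h0 le_rfl]
    exact hN
  edges i hi := by
    rw [ofCuts_n] at hi
    rw [ofCuts_edge hi]
    exact he i hi
  init := by
    rw [ofCuts_state hn]
    exact hi

end ofCuts
end RawExec

/-- A finite set in a linear order is enumerated increasingly. -/
lemma exists_increasing_enum {α : Type*} [LinearOrder α] [Inhabited α] (s : Finset α) :
    ∃ f : ℕ → α, (∀ i, i < s.card → f i ∈ s) ∧ (∀ i j, i < j → j < s.card → f i < f j) ∧
      ∀ a ∈ s, ∃ i, i < s.card ∧ f i = a := by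
  let g := s.orderEmbOfFin rfl
  refine ⟨fun i => if h : i < s.card then g ⟨i, h⟩ else default, ?_, ?_, ?_⟩
  · intro i hi
    simp only [hi, dite_true]
    exact s.orderEmbOfFin_mem rfl _
  · intro i j hij hj
    simp only [hj, hij.trans hj, dite_true]
    exact g.strictMono hij
  · intro a ha
    have : a ∈ Set.range g := by rw [s.range_orderEmbOfFin rfl]; exact ha
    obtain ⟨i, hi⟩ := this
    exact ⟨i, i.2, by simpa using hi⟩

namespace FlowOK
variable {A : TA ℕ} {N : ℝ} {w : ℝ → Set (MPred ℕ)}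

/-- The cut at which the encoded execution ends. -/
lemma exists_end (hN : 0 < N) (hf : FlowOK A N w) :
    ∃ H : Cut, at' 0 false < H ∧ H ≤ at' N false ∧
      ∀ t ∈ Ico (0 : ℝ) N, Alive A w t ↔ at' t true ≤ H := by
  classical
  have h0 : (0 : ℝ) ∈ Ico (0 : ℝ) N := ⟨le_rfl, hN⟩
  obtain ⟨v, hv, hv0⟩ := hf.init 0 h0 (fun u hu => hu.1.not_gt)
  have hA0 : Alive A w 0 := ⟨v, TA.init_visited hv, hv0⟩
  set s : Set ℝ := {t | t ∈ Ico (0 : ℝ) N ∧ Alive A w t} with hs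
  have hne : s.Nonempty := ⟨0, h0, hA0⟩
  have hbd : BddAbove s := ⟨N, fun t ht => ht.1.2.le⟩
  have hall : ∀ t ∈ Ico (0 : ℝ) N, Alive A w t ↔ at' t true ≤ at' (sSup s) (decide (sSup s ∈ s)) := by
    intro t ht
    rw [at_le_at]
    simp only [decide_eq_true_eq, forall_const]
    constructor
    · intro ha
      rcases (le_csSup hbd (show t ∈ s from ⟨ht, ha⟩)).lt_or_eq with h | h
      · exact Or.inl h
      · exact Or.inr ⟨h, h ▸ ⟨ht, ha⟩⟩
    · rintro (h | ⟨h, h'⟩)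
      · obtain ⟨u, hu, htu⟩ := exists_lt_of_lt_csSup hne h
        exact hf.alive_down t ht u hu.1 htu hu.2
      · rw [h]; exact h'.2
  refine ⟨_, true_le_iff.1 ((hall 0 h0).1 hA0), ?_, hall⟩
  rw [at_le_at]
  rcases (csSup_le hne fun t ht => ht.1.2.le : sSup s ≤ N).lt_or_eq with h | h
  · exact Or.inl h
  · refine Or.inr ⟨h, fun hm => ?_⟩
    have hm' : sSup s ∈ s := by simpa using hm
    exact absurd hm'.1.2 h.not_lt

lemma exists_exec (hN : 0 < N) (hf : FlowOK A N w)
    (hfin : {c : Cut | c.time ∈ Ico 0 N ∧ ∃ e ∈ A.edges, evm e c.side ∈ w c.time}.Finite) :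
    ∃ ρ, RawExec.Shape A N ρ ∧ Agrees A N w ρ := by
  classical
  have h0 : (0 : ℝ) ∈ Ico (0 : ℝ) N := ⟨le_rfl, hN⟩
  obtain ⟨v, hv, hv0⟩ := hf.init 0 h0 (fun u hu => hu.1.not_gt)
  obtain ⟨H, hH0, hHN, hH⟩ := hf.exists_end hN
  have : Inhabited Cut := ⟨at' 0 false⟩
  obtain ⟨ev, hev, hmono, hsurj⟩ := exists_increasing_enum hfin.toFinset
  set K := hfin.toFinset.card
  simp only [Finite.mem_toFinset, mem_ofPred_eq] at hev hsurj
  choose! hevD E hE hEw using hev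
  have hevs : ∀ i, i < K → ev i = at' (ev i).time (ev i).side := fun i _ => rfl
  have hnat : ∀ t ∈ Ico (0 : ℝ) N, ∀ b, ∀ e ∈ A.edges, evm e b ∈ w t →
      ∃ i, i < K ∧ ev i = at' t b ∧ E i = e := by
    intro t ht b e he hw
    obtain ⟨i, hi, hi'⟩ := hsurj (at' t b) ⟨ht, e, he, hw⟩
    refine ⟨i, hi, hi', ?_⟩
    have h1 := hEw i hi
    rw [hi'] at h1
    exact hf.ev_unique t ht b _ (hE i hi) _ he h1 hw
  have hev0 : ∀ i, i < K → at' 0 false < ev i := by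
    intro i hi
    have h1 := hevD i hi
    have h2 := hEw i hi
    rw [hevs i hi, at_lt_at]
    rcases h1.1.lt_or_eq with h | h
    · exact Or.inl h
    · refine Or.inr ⟨h, rfl, ?_⟩
      by_contra hb
      rw [Bool.not_eq_true] at hb
      rw [hb] at h2
      obtain ⟨-, u, hu, hut, -⟩ := hf.minus _ h1 _ (hE i hi) h2
      exact absurd hu.1 (by rw [h]; exact hut.not_ge)
  have hevH : ∀ i, i < K → ev i < H := by
    intro i hi
    have h1 := hevD i hi
    have h2 := hEw i hi
    rw [hevs i hi]
    cases hb : (ev i).side with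
    | false =>
      rw [hb] at h2
      refine true_le_iff.1 ((hH _ h1).1 ⟨_, TA.dst_visited (hE i hi), ?_⟩)
      exact (hf.minus _ h1 _ (hE i hi) h2).1
    | true =>
      rw [hb] at h2
      obtain ⟨-, u, hu, hut, hr⟩ := hf.plus _ h1 _ (hE i hi) h2
      have hm : ((ev i).time + u) / 2 ∈ Ico 0 N :=
        ⟨by linarith [h1.1, hu.1], by linarith [h1.2, hu.2]⟩
      have := (hr _ hm (by linarith) (by linarith)).1
      exact (at_lt_at.2 (Or.inl (by linarith))).trans_le
        ((hH _ hm).1 ⟨_, TA.dst_visited (hE i hi), this⟩)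
  let c : ℕ → Cut := fun i => match i with
    | 0 => at' 0 false
    | i + 1 => if i < K then ev i else H
  let st : ℕ → ℕ := fun i => match i with
    | 0 => v
    | i + 1 => (E i).2.1
  have hc1 : ∀ i, i < K → c (i + 1) = ev i := fun i hi => if_pos hi
  have hcK : c (K + 1) = H := if_neg (lt_irrefl K)
  have hcs : ∀ i, i < K + 1 → c i < c (i + 1) := by
    intro i hi
    cases i with
    | zero =>
      by_cases h : 0 < K
      · rw [hc1 0 h]; exact hev0 0 h
      · have : K = 0 := by omega
        rw [this] at hcK
        rw [hcK]; exact hH0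
    | succ k =>
      rw [hc1 k (by omega)]
      by_cases h : k + 1 < K
      · rw [hc1 (k + 1) h]; exact hmono _ _ (by omega) h
      · have : K = k + 1 := by omega
        rw [← this, hcK]; exact hevH k (by omega)
  have hst_vis : ∀ i, i < K + 1 → st i ∈ A.visited := by
    intro i hi
    cases i with
    | zero => exact TA.init_visited hv
    | succ k => exact TA.dst_visited (hE k (by omega))
  have hcH : ∀ i, i ≤ K + 1 → c i ≤ H := by
    intro i hi
    rcases Nat.lt_or_ge i (K + 1) with h | h
    · cases i with
      | zero => exact hH0.le
      | succ k => rw [hc1 k (by omega)]; exact (hevH k (by omega)).le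
    · rw [show i = K + 1 by omega, hcK]
  have hevgt : ∀ i j, i < K + 1 → j < K → c i < ev j → c (i + 1) ≤ ev j := by
    intro i j hi hj hlt
    cases i with
    | zero =>
      rw [hc1 0 (by omega)]
      rcases Nat.eq_zero_or_pos j with rfl | h
      · exact le_rfl
      · exact (hmono 0 j h hj).le
    | succ k =>
      rw [hc1 k (by omega)] at hlt
      have hkj : k < j := by
        by_contra! hjk
        rcases hjk.lt_or_eq with h | h
        · exact absurd (hmono _ _ h (by omega)) hlt.not_gt
        · rw [h] at hlt; exact lt_irrefl _ hlt
      rw [hc1 (k + 1) (by omega)]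
      rcases Nat.lt_or_ge (k + 1) j with h | h
      · exact (hmono _ _ h hj).le
      · rw [show k + 1 = j by omega]
  have hprop : ∀ i, i < K + 1 → ∀ s ∈ Ico (0 : ℝ) N, ∀ t ∈ Ico (0 : ℝ) N, s ≤ t →
      (∀ d, at' s false < d → c i < d) → at' t true ≤ c (i + 1) →
      .st (st i) ∈ w s → .st (st i) ∈ w t := by
    intro i hi s hs t ht hst hcs' hct hw
    rcases hst.eq_or_lt with rfl | hlt
    · exact hw
    · refine hf.cont s hs t ht hlt ((hH t ht).2 (hct.trans (hcH _ hi))) ?_ _ (hst_vis i hi) hw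
      intro r hr b hr1 hr2 e he hwe
      obtain ⟨j, hj, hj', -⟩ := hnat r hr b e he hwe
      rw [← hj'] at hr1 hr2
      exact absurd ((hevgt i j hi hj (hcs' _ hr1)).trans_lt hr2) hct.not_gt
  have hstate : ∀ i, i < K + 1 → ∀ t ∈ Ico (0 : ℝ) N, c i ≤ at' t false →
      at' t true ≤ c (i + 1) → .st (st i) ∈ w t := by
    intro i hi t ht h1 h2
    cases i with
    | zero => exact hprop 0 hi 0 h0 t ht ht.1 (fun d hd => hd) h2 hv0
    | succ k =>
      have hk : k < K := by omega
      have hD := hevD k hk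
      have hw := hEw k hk
      have hck : c (k + 1) = at' (ev k).time (ev k).side := hc1 k hk
      cases hb : (ev k).side with
      | false =>
        rw [hb] at hw hck
        refine hprop (k + 1) hi _ hD t ht ?_ (fun d hd => hck ▸ hd) h2
          (hf.minus _ hD _ (hE k hk) hw).1
        have := time_mono h1
        rw [hck] at this
        exact this
      | true =>
        rw [hb] at hw hck
        have hlt : (ev k).time < t := by
          rw [hck, at_le_at] at h1
          simpa using h1
        obtain ⟨-, u, hu, hut, hr⟩ := hf.plus _ hD _ (hE k hk) hw
        obtain ⟨r, hr1, hr2⟩ := exists_between (lt_min hut hlt)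
        rw [lt_min_iff] at hr2
        have hrD : r ∈ Ico 0 N := ⟨hD.1.trans hr1.le, hr2.1.trans hu.2⟩
        refine hprop (k + 1) hi r hrD t ht hr2.2.le (fun d hd => ?_) h2 (hr r hrD hr1 hr2.1).1
        rw [hck]
        exact (at_lt_at.2 (Or.inl hr1)).trans hd
  have hci0 : ∀ i, i ≤ K + 1 → 0 ≤ (c i).time := by
    intro i hi
    cases i with
    | zero => exact le_rfl
    | succ k =>
      rcases Nat.lt_or_ge k K with h | h
      · rw [hc1 k h]; exact (hevD k h).1
      · rw [show k = K by omega, hcK]; exact time_mono hH0.le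
  have hsrc : ∀ i, i < K → st i = (E i).1 := by
    intro i hi
    have hD := hevD i hi
    have hw := hEw i hi
    have hck : c (i + 1) = at' (ev i).time (ev i).side := hc1 i hi
    have hlt := hcs i (by omega)
    cases hb : (ev i).side with
    | false =>
      rw [hb] at hw hck
      obtain ⟨-, u, hu, hut, hr⟩ := hf.minus _ hD _ (hE i hi) hw
      rw [hck, ← at_eta (c i), at_lt_at] at hlt
      simp only [Bool.false_eq_true, and_false, or_false] at hlt
      obtain ⟨r, hr1, hr2⟩ := exists_between (max_lt hut hlt)
      rw [max_lt_iff] at hr1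
      have hrD : r ∈ Ico 0 N := ⟨hu.1.trans hr1.1.le, hr2.trans hD.2⟩
      refine hf.st_unique r hrD _ (hst_vis i (by omega)) _ (TA.src_visited (hE i hi))
        (hstate i (by omega) r hrD ?_ ?_) (hr r hrD hr1.1 hr2).1
      · exact (lt_of_time_lt hr1.2).le
      · rw [hck]; exact (at_lt_at.2 (Or.inl hr2)).le
    | true =>
      rw [hb] at hw hck
      refine hf.st_unique _ hD _ (hst_vis i (by omega)) _ (TA.src_visited (hE i hi))
        (hstate i (by omega) _ hD ?_ hck.ge) (hf.plus _ hD _ (hE i hi) hw).1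
      rw [hck] at hlt
      exact le_false_iff.2 hlt
  have hedge : ∀ i, i < K → (st i, st (i + 1), (E i).2.2.1, (E i).2.2.2) = E i := by
    intro i hi
    rw [hsrc i hi]
  have hshape : RawExec.Shape A N
      (RawExec.ofCuts (K + 1) c st (fun i => (E i).2.2.1) (fun i => (E i).2.2.2)) := by
    refine RawExec.ofCuts_shape rfl (by omega) hcs (by rw [hcK]; exact hHN) ?_ hv
    intro i hi
    rw [hedge i (by omega)]
    exact hE i (by omega)
  have hbnd : ∀ i, i ≤ K + 1 → (RawExec.ofCuts (K + 1) c st (fun i => (E i).2.2.1)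
      (fun i => (E i).2.2.2)).bnd i = c i := fun i hi => RawExec.ofCuts_bnd rfl hi
  refine ⟨_, hshape, fun t ht => ⟨fun u hu => ?_, fun e he b => ?_⟩⟩
  · rw [hshape.st_mem_iota]
    simp only [RawExec.ofCuts_n]
    constructor
    · intro hut
      have hle := (hH t ht).1 ⟨u, hu, hut⟩
      obtain ⟨i, hi, h1, h2⟩ := RawExec.Shape.exists_slot (ρ := RawExec.ofCuts (K + 1) c st
        (fun i => (E i).2.2.1) (fun i => (E i).2.2.2)) (d := at' t true)
        (by rw [at_lt_at]; rcases ht.1.lt_or_eq with h | h <;> simp [h])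
        (by rw [RawExec.ofCuts_n, hbnd _ le_rfl, hcK]; exact hle)
      rw [RawExec.ofCuts_n] at hi
      refine ⟨i, hi, ⟨le_false_iff.2 h1, h2⟩, ?_⟩
      rw [RawExec.ofCuts_state hi]
      rw [hbnd _ hi.le] at h1
      rw [hbnd _ hi] at h2
      exact hf.st_unique t ht _ (hst_vis i hi) _ hu (hstate i hi t ht (le_false_iff.2 h1) h2) hut
    · rintro ⟨i, hi, ⟨h1, h2⟩, rfl⟩
      rw [RawExec.ofCuts_state hi]
      rw [hbnd _ hi.le] at h1
      rw [hbnd _ hi] at h2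
      exact hstate i hi t ht h1 h2
  · rw [hshape.evm_mem_iota]
    simp only [RawExec.ofCuts_n]
    constructor
    · intro hw
      obtain ⟨i, hi, hi', rfl⟩ := hnat t ht b e he hw
      refine ⟨i, by omega, ?_, ?_⟩
      · rw [RawExec.ofCuts_edge (by omega)]; exact hedge i hi
      · rw [hbnd _ (by omega), hc1 i hi]; exact hi'
    · rintro ⟨i, hi, rfl, hb⟩
      have hi' : i < K := by omega
      rw [hbnd _ (by omega), hc1 i hi'] at hb
      rw [RawExec.ofCuts_edge hi, hedge i hi']
      have := hEw i hi'
      rw [hb] at this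
      exact this

end FlowOK
end HyTime

namespace HyTime
open Cut Set

/-! ### Equality of executions up to a time -/

lemma take_eq_take_iff_getD {α : Type} (d : α) {l l' : List α} {i : ℕ} (h : i ≤ l.length)
    (h' : i ≤ l'.length) :
    l.take i = l'.take i ↔ ∀ j, j < i → l.getD j d = l'.getD j d := by
  constructor
  · intro he j hj
    have := congrArg (fun k => k[j]?) he
    simp only [List.getElem?_take, hj, if_true] at this
    rw [List.getD_eq_getElem?_getD, List.getD_eq_getElem?_getD, this]
  · intro he
    apply List.ext_getElem (by simp [h, h'])
    intro j h1 h2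
    have hj : j < i := by simp at h1; omega
    have := he j hj
    rw [List.getD_eq_getElem _ _ (by omega), List.getD_eq_getElem _ _ (by omega)] at this
    simpa using this

namespace RawExec.Shape
variable {A : TA ℕ} {N : ℝ} {ρ ρ' : RawExec ℕ}

lemma bnd_succ (ρ : RawExec ℕ) (i : ℕ) :
    ρ.bnd (i + 1) = at' (ρ.ivl i).hi (ρ.ivl i).hiC := rfl

lemma idxAt_eq (h : Shape A N ρ) {i : ℕ} {t : ℝ} (hi : i < ρ.n) (ht : TIvl.Mem t (ρ.ivl i)) :
    ρ.idxAt t = i := by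
  have hl := h.ivls_length
  have hg : ∀ j (hj : j < ρ.ivls.length), ρ.ivls[j] = ρ.ivl j := fun j hj =>
    (List.getD_eq_getElem _ _ hj).symm
  unfold idxAt
  rw [List.findIdx_eq (by omega)]
  refine ⟨by simpa [hg] using ht, fun j hj => ?_⟩
  rw [hg j (by omega), decide_eq_false_iff_not]
  intro hm
  have := h.index_unique (by omega) hi hm ht
  omega

lemma idxAt_eq_n (h : Shape A N ρ) {t : ℝ} (ht : ¬ MemLen t ρ) : ρ.idxAt t = ρ.n := by
  have hl := h.ivls_length
  rw [← hl]
  unfold idxAt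
  rw [List.findIdx_eq_length]
  intro I hI
  rw [decide_eq_false_iff_not]
  intro hm
  obtain ⟨j, hj, rfl⟩ := List.getElem_of_mem hI
  exact ht ⟨j, by omega, by rwa [RawExec.ivl, List.getD_eq_getElem _ _ hj]⟩

lemma eqUpTo_iff_index (h : Shape A N ρ) (h' : Shape A N ρ') {t : ℝ} (ht : MemLen t ρ') :
    EqUpTo ρ ρ' t ↔ ∃ i, (i < ρ.n ∧ i < ρ'.n) ∧ TIvl.Mem t (ρ.ivl i) ∧ TIvl.Mem t (ρ'.ivl i) ∧
      (∀ j, j ≤ i → ρ.bnd j = ρ'.bnd j) ∧ (∀ j, j ≤ i → ρ.state j = ρ'.state j) ∧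
      ∀ j, j < i → ρ.edge j = ρ'.edge j := by
  have hl := h.ivls_length
  have hl' := h'.ivls_length
  have hg := h.guards_length
  have hg' := h'.guards_length
  have hr := h.resets_length
  have hr' := h'.resets_length
  have hn : ρ.states.length = ρ.n := rfl
  have hn' : ρ'.states.length = ρ'.n := rfl
  unfold EqUpTo prefixUpTo
  simp only [RawExec.mk.injEq]
  constructor
  · rintro ⟨h1, h2, h3, h4⟩
    obtain ⟨i', hi', hm'⟩ := ht
    rw [h'.idxAt_eq hi' hm'] at h1 h2 h3 h4
    by_cases htl : MemLen t ρ
    · obtain ⟨i, hi, hm⟩ := htl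
      rw [h.idxAt_eq hi hm] at h1 h2 h3 h4
      have hii : i = i' := by
        have := congrArg List.length h2
        simp only [List.length_append, List.length_take, List.length_singleton] at this
        omega
      subst hii
      rw [take_eq_take_iff_getD 0 (by omega) (by omega)] at h1
      have h2' := (List.append_inj_left h2 (by simp; omega))
      rw [take_eq_take_iff_getD default (by omega) (by omega)] at h2'
      rw [take_eq_take_iff_getD [] (by omega) (by omega)] at h3 h4
      have hst : ∀ j, j ≤ i → ρ.state j = ρ'.state j := fun j hj => h1 j (by omega)
      refine ⟨i, ⟨hi, hi'⟩, hm, hm', ?_, hst, ?_⟩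
      · rintro (_ | j) hj
        · rfl
        · have : ρ.ivl j = ρ'.ivl j := h2' j hj
          rw [bnd_succ, bnd_succ, this]
      · intro j hj
        unfold edge
        have e1 : ρ.guard j = ρ'.guard j := h3 j hj
        have e2 : ρ.reset j = ρ'.reset j := h4 j hj
        rw [hst j hj.le, hst (j + 1) hj, e1, e2]
    · rw [h.idxAt_eq_n htl] at h1 h2
      have e1 := congrArg List.length h1
      have e2 := congrArg List.length h2
      simp only [List.length_append, List.length_take, List.length_singleton] at e1 e2
      omega
  · rintro ⟨i, ⟨hi, hi'⟩, hm, hm', hb, hst, he⟩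
    rw [h.idxAt_eq hi hm, h'.idxAt_eq hi' hm']
    have hlo : ∀ j, j ≤ i → (ρ.ivl j).lo = (ρ'.ivl j).lo ∧ (ρ.ivl j).loC = (ρ'.ivl j).loC := by
      intro j hj
      have := (h.low j (by omega)).trans ((hb j hj).trans (h'.low j (by omega)).symm)
      rw [at_inj] at this
      simpa using this
    refine ⟨?_, ?_, ?_, ?_⟩
    · rw [take_eq_take_iff_getD 0 (by omega) (by omega)]
      exact fun j hj => hst j (by omega)
    · congr 1
      · rw [take_eq_take_iff_getD default (by omega) (by omega)]
        intro j hj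
        change ρ.ivl j = ρ'.ivl j
        have h1 := hlo j hj.le
        have h2 := hb (j + 1) hj
        rw [bnd_succ, bnd_succ, at_inj] at h2
        rcases hI : ρ.ivl j with ⟨a, b, c, d⟩
        rcases hJ : ρ'.ivl j with ⟨a', b', c', d'⟩
        simp_all
      · rw [(hlo i le_rfl).1, (hlo i le_rfl).2]
    · rw [take_eq_take_iff_getD [] (by omega) (by omega)]
      exact fun j hj => congrArg (fun e => e.2.2.1) (he j hj)
    · rw [take_eq_take_iff_getD [] (by omega) (by omega)]
      exact fun j hj => congrArg (fun e => e.2.2.2) (he j hj)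

/-- The encodings of `ρ` and `ρ'` agree up to time `t`. -/
def SameUpTo (A : TA ℕ) (N : ℝ) (w w' : ℝ → Set (MPred ℕ)) (t : ℝ) : Prop :=
  (∀ s ∈ Ico (0 : ℝ) N, ¬ t < s → ∀ v ∈ A.visited, (.st v ∈ w s ↔ .st v ∈ w' s)) ∧
    ∀ s ∈ Ico (0 : ℝ) N, ∀ b, at' s b < at' t true → ∀ e ∈ A.edges,
      (evm e b ∈ w s ↔ evm e b ∈ w' s)

lemma iota_imp_of_index (h : Shape A N ρ) (h' : Shape A N ρ') {t : ℝ} {i : ℕ} (hi : i < ρ.n)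
    (hi' : i < ρ'.n) (hm : TIvl.Mem t (ρ.ivl i)) (hm' : TIvl.Mem t (ρ'.ivl i))
    (hb : ∀ j, j ≤ i → ρ.bnd j = ρ'.bnd j) (hst : ∀ j, j ≤ i → ρ.state j = ρ'.state j)
    (he : ∀ j, j < i → ρ.edge j = ρ'.edge j) :
    (∀ s v, ¬ t < s → MPred.st v ∈ iota ρ s → MPred.st v ∈ iota ρ' s) ∧
      ∀ s b e, at' s b < at' t true → evm e b ∈ iota ρ s → evm e b ∈ iota ρ' s := by
  rw [h.mem_iff hi] at hm
  rw [h'.mem_iff hi'] at hm'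
  constructor
  · intro s v hs hv
    rw [h.st_mem_iota] at hv
    obtain ⟨j, hj, ⟨h1, h2⟩, rfl⟩ := hv
    have hst' : at' s true ≤ at' t true := at_le_at.2 ((not_lt.1 hs).lt_or_eq.imp id (by simp))
    have hji : j < i + 1 := h.lt_of_bnd_lt hj.le
      ((le_false_iff.1 h1).trans_le (hst'.trans hm.2))
    rw [h'.st_mem_iota]
    refine ⟨j, by omega, ⟨hb j (by omega) ▸ h1, ?_⟩, (hst j (by omega)).symm⟩
    rcases (Nat.lt_succ_iff.1 hji).lt_or_eq with hlt | rfl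
    · rw [← hb (j + 1) hlt]; exact h2
    · exact hst'.trans hm'.2
  · intro s b e hs hv
    rw [h.evm_mem_iota] at hv
    obtain ⟨j, hj, rfl, h1⟩ := hv
    have hji : j + 1 < i + 1 := h.lt_of_bnd_lt (by omega) (by
      rw [h1]; exact hs.trans_le hm.2)
    rw [h'.evm_mem_iota]
    exact ⟨j, by omega, (he j (by omega)).symm, by rw [← hb (j + 1) (by omega), h1]⟩

/-- If the markers of `ρ` up to `t` are markers of `ρ'`, then the boundaries of `ρ` up to `t`
are boundaries of `ρ'`. -/
lemma bnd_of_markers (h : Shape A N ρ) (h' : Shape A N ρ') {t : ℝ} {i : ℕ} (hi : i < ρ.n)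
    (hm : TIvl.Mem t (ρ.ivl i))
    (hev : ∀ s ∈ Ico (0 : ℝ) N, ∀ b, at' s b < at' t true → ∀ e ∈ A.edges,
      (evm e b ∈ iota ρ s → evm e b ∈ iota ρ' s)) {j : ℕ} (hj : j < i) :
    ∃ k, k + 1 < ρ'.n ∧ ρ'.edge k = ρ.edge j ∧ ρ'.bnd (k + 1) = ρ.bnd (j + 1) := by
  have h1 : ρ.bnd (j + 1) < at' t true :=
    (h.bnd_le (show j + 1 ≤ i by omega) hi.le).trans_lt
      (le_false_iff.1 ((h.mem_iff hi t).1 hm).1)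
  have := hev _ ⟨h.time_nonneg (by omega), h.time_lt (by omega)⟩ (ρ.bnd (j + 1)).side
    (by rwa [at_eta]) _ (h.edges j (by omega))
    ((h.evm_mem_iota _ _ _).2 ⟨j, by omega, rfl, (at_eta _).symm⟩)
  rw [h'.evm_mem_iota] at this
  simpa using this

lemma bnd_succ_le_of_markers (h : Shape A N ρ) (h' : Shape A N ρ') {t : ℝ} {i : ℕ}
    (hi : i < ρ.n) (hm : TIvl.Mem t (ρ.ivl i))
    (hev : ∀ s ∈ Ico (0 : ℝ) N, ∀ b, at' s b < at' t true → ∀ e ∈ A.edges,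
      (evm e b ∈ iota ρ s → evm e b ∈ iota ρ' s)) {j : ℕ} (hj : j < i) (hj' : j ≤ ρ'.n)
    (hb : ρ.bnd j = ρ'.bnd j) : ρ'.bnd (j + 1) ≤ ρ.bnd (j + 1) := by
  obtain ⟨k, hk, -, hk2⟩ := h.bnd_of_markers h' hi hm hev hj
  rw [← hk2]
  refine h'.bnd_le (h'.lt_of_bnd_lt hj' ?_) hk.le
  rw [← hb, hk2]
  exact h.bnd_lt (Nat.lt_succ_self j) (by omega)

lemma index_le_of_markers (h : Shape A N ρ) (h' : Shape A N ρ') {t : ℝ} {i i' : ℕ}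
    (hi : i < ρ.n) (hm : TIvl.Mem t (ρ.ivl i)) (hi' : i' < ρ'.n) (hm' : TIvl.Mem t (ρ'.ivl i'))
    (hev : ∀ s ∈ Ico (0 : ℝ) N, ∀ b, at' s b < at' t true → ∀ e ∈ A.edges,
      (evm e b ∈ iota ρ s → evm e b ∈ iota ρ' s)) (hb : ρ.bnd i' = ρ'.bnd i') : i ≤ i' := by
  by_contra! hlt
  obtain ⟨k, hk, -, hk2⟩ := h.bnd_of_markers h' hi hm hev hlt
  have h1 : ρ.bnd (i' + 1) ≤ at' t false :=
    (h.bnd_le hlt hi.le).trans ((h.mem_iff hi t).1 hm).1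
  have h2 : k + 1 < i' + 1 := h'.lt_of_bnd_lt (by omega)
    ((le_false_iff.1 (hk2 ▸ h1)).trans_le ((h'.mem_iff hi' t).1 hm').2)
  have h3 : ρ'.bnd (k + 1) ≤ ρ'.bnd i' := h'.bnd_le (by omega) hi'.le
  rw [hk2, ← hb] at h3
  exact absurd h3 (h.bnd_lt (Nat.lt_succ_self i') (by omega)).not_ge

lemma eqUpTo_iff (h : Shape A N ρ) (h' : Shape A N ρ') {t : ℝ} (ht : MemLen t ρ') :
    EqUpTo ρ ρ' t ↔ SameUpTo A N (iota ρ) (iota ρ') t := by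
  rw [h.eqUpTo_iff_index h' ht]
  constructor
  · rintro ⟨i, ⟨hi, hi'⟩, hm, hm', hb, hst, he⟩
    have h1 := h.iota_imp_of_index h' hi hi' hm hm' hb hst he
    have h2 := h'.iota_imp_of_index h hi' hi hm' hm (fun j hj => (hb j hj).symm)
      (fun j hj => (hst j hj).symm) (fun j hj => (he j hj).symm)
    exact ⟨fun s _ hs v _ => ⟨h1.1 s v hs, h2.1 s v hs⟩,
      fun s _ b hs e _ => ⟨h1.2 s b e hs, h2.2 s b e hs⟩⟩
  · rintro ⟨hS, hE⟩
    obtain ⟨i', hi', hm'⟩ := ht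
    have htD : t ∈ Ico 0 N := ⟨h'.nonneg_of_mem hi' hm', h'.lt_of_mem hi' hm'⟩
    obtain ⟨i, hi, hm, hsi⟩ := (hS t htD (lt_irrefl t) _ (h'.state_visited hi')).2
      ⟨i', hi', hm', rfl⟩
    have hE1 := fun s hs b hb e he => (hE s hs b hb e he).1
    have hE2 := fun s hs b hb e he => (hE s hs b hb e he).2
    have hb : ∀ j, j ≤ i → j ≤ i' → ρ.bnd j = ρ'.bnd j := by
      intro j
      induction j with
      | zero => intro _ _; rfl
      | succ j ih =>
        intro h1 h2
        have ih := ih (by omega) (by omega)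
        exact le_antisymm
          (h'.bnd_succ_le_of_markers h hi' hm' hE2 h2 (by omega) ih.symm)
          (h.bnd_succ_le_of_markers h' hi hm hE1 h1 (by omega) ih)
    have hii : i = i' := by
      rcases le_total i i' with hl | hl
      · exact hl.antisymm
          (h'.index_le_of_markers h hi' hm' hi hm hE2 (hb i le_rfl hl).symm)
      · exact (h.index_le_of_markers h' hi hm hi' hm' hE1 (hb i' hl le_rfl)).antisymm hl
    subst hii
    have hb' : ∀ j, j ≤ i → ρ.bnd j = ρ'.bnd j := fun j hj => hb j hj hj
    have he : ∀ j, j < i → ρ.edge j = ρ'.edge j := by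
      intro j hj
      obtain ⟨k, hk, hk1, hk2⟩ := h.bnd_of_markers h' hi hm hE1 hj
      rw [hb' (j + 1) hj] at hk2
      have := h'.eq_of_bnd_eq hk.le (by omega) hk2
      obtain rfl : k = j := by omega
      exact hk1.symm
    refine ⟨i, ⟨hi, hi'⟩, hm, hm', hb', fun j hj => ?_, he⟩
    rcases hj.lt_or_eq with hj | rfl
    · exact congrArg (fun e => e.1) (he j hj)
    · exact hsi

end RawExec.Shape
end HyTime

namespace HyTime
open Cut Set

/-! ### Finite variability -/

lemma FinVar.map {σ τ : Type} {D : Set ℝ} {f : ℝ → Set σ} (hf : FinVar D f)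
    (F : Set σ → Set τ) : FinVar D (fun t => F (f t)) := by
  intro a b
  refine (hf a b).subset ?_
  rintro t ⟨ht, hc⟩
  refine ⟨ht, fun ⟨ε, hε, h⟩ => hc ⟨ε, hε, fun s hs hst => ?_⟩⟩
  exact congrArg F (h s hs hst)

lemma FinVar.map₂ {σ τ υ : Type} {D : Set ℝ} {f : ℝ → Set σ} {g : ℝ → Set τ} (hf : FinVar D f)
    (hg : FinVar D g) (F : Set σ → Set τ → Set υ) : FinVar D (fun t => F (f t) (g t)) := by
  intro a b
  refine ((hf a b).union (hg a b)).subset ?_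
  rintro t ⟨ht, hc⟩
  by_contra hn
  simp only [mem_union, mem_ofPred_eq, ht, true_and, not_or, not_not] at hn
  obtain ⟨⟨ε, hε, h⟩, ⟨δ, hδ, h'⟩⟩ := hn
  refine hc ⟨min ε δ, lt_min hε hδ, fun s hs hst => ?_⟩
  rw [lt_min_iff] at hst
  change F (f s) (g s) = F (f t) (g t)
  rw [h s hs hst.1, h' s hs hst.2]

/-- A flow that only changes at finitely many times is finitely variable. -/
lemma finVar_of_finite {σ : Type} {D T : Set ℝ} {f : ℝ → Set σ} (hT : T.Finite)
    (hf : ∀ s t, s ≤ t → (∀ τ ∈ T, ¬ (s ≤ τ ∧ τ ≤ t)) → f s = f t) : FinVar D f := by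
  intro a b
  refine hT.subset ?_
  rintro t ⟨-, hc⟩
  by_contra ht
  obtain ⟨ε, hε, hball⟩ := Metric.isOpen_iff.1 hT.isClosed.isOpen_compl t ht
  refine hc ⟨ε, hε, fun s _ hst => ?_⟩
  rcases le_total s t with hl | hl
  · refine hf s t hl fun τ hτ hb => hball (?_ : τ ∈ Metric.ball t ε) hτ
    rw [Metric.mem_ball, Real.dist_eq, abs_lt]
    rw [abs_lt] at hst
    constructor <;> linarith
  · refine (hf t s hl fun τ hτ hb => hball (?_ : τ ∈ Metric.ball t ε) hτ).symm
    rw [Metric.mem_ball, Real.dist_eq, abs_lt]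
    rw [abs_lt] at hst
    constructor <;> linarith

namespace RawExec.Shape
variable {A : TA ℕ} {N : ℝ} {ρ : RawExec ℕ}

lemma iota_congr (h : Shape A N ρ) {s t : ℝ} (hst : s ≤ t)
    (hT : ∀ i, i ≤ ρ.n → ¬ (s ≤ (ρ.bnd i).time ∧ (ρ.bnd i).time ≤ t)) : iota ρ s = iota ρ t := by
  have hlo : ∀ i r, i < ρ.n → s ≤ r → r ≤ t → r ≠ (ρ.ivl i).lo := by
    rintro i r hi h1 h2 rfl
    rw [h.lo_eq hi] at h1 h2
    exact hT i hi.le ⟨h1, h2⟩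
  have hhi : ∀ i r, i < ρ.n → s ≤ r → r ≤ t → r ≠ (ρ.ivl i).hi := by
    rintro i r hi h1 h2 rfl
    exact hT (i + 1) hi ⟨h1, h2⟩
  have hmem : ∀ i, i < ρ.n → (TIvl.Mem s (ρ.ivl i) ↔ TIvl.Mem t (ρ.ivl i)) := by
    intro i hi
    have h1 := hT i hi.le
    have h2 := hT (i + 1) hi
    rw [h.mem_iff hi, h.mem_iff hi, ← at_eta (ρ.bnd i), ← at_eta (ρ.bnd (i + 1))]
    simp only [at_le_at, not_and, not_le] at h1 h2 ⊢
    constructor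
    · rintro ⟨h3, h4⟩
      refine ⟨Or.inl ?_, Or.inl (h2 ?_)⟩
      · rcases h3 with h3 | h3
        · linarith
        · have := h1 h3.1.ge; linarith [h3.1]
      · rcases h4 with h4 | h4
        · exact h4.le
        · exact h4.1.le
    · rintro ⟨h3, h4⟩
      refine ⟨Or.inl ?_, Or.inl ?_⟩
      · by_contra! hc
        have := h1 hc
        rcases h3 with h3 | h3 <;> linarith
      · rcases h4 with h4 | h4
        · linarith
        · linarith [h2 (hst.trans h4.1.le), h4.1]
  ext mp
  cases mp with
  | st v => exact exists_congr fun i => and_congr_right fun hi => and_congr (hmem i hi) Iff.rfl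
  | tminus e =>
    constructor
    · rintro ⟨i, hi, -, he, -⟩; exact absurd he (hlo _ s hi le_rfl hst)
    · rintro ⟨i, hi, -, he, -⟩; exact absurd he (hlo _ t hi hst le_rfl)
  | tplus e =>
    constructor
    · rintro ⟨i, hi, -, he, -⟩; exact absurd he (hhi _ s (by omega) le_rfl hst)
    · rintro ⟨i, hi, -, he, -⟩; exact absurd he (hhi _ t (by omega) hst le_rfl)
  | r0 x =>
    constructor
    · rintro ⟨i, hi, -, he, -⟩; exact absurd he (hlo _ s hi le_rfl hst)
    · rintro ⟨i, hi, -, he, -⟩; exact absurd he (hlo _ t hi hst le_rfl)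
  | r1 x =>
    constructor
    · rintro ⟨i, hi, -, he, -⟩; exact absurd he (hhi _ s (by omega) le_rfl hst)
    · rintro ⟨i, hi, -, he, -⟩; exact absurd he (hhi _ t (by omega) hst le_rfl)

lemma finVar_iota (h : Shape A N ρ) (D : Set ℝ) : FinVar D (iota ρ) :=
  finVar_of_finite (T := (fun i => (ρ.bnd i).time) '' Iic ρ.n) ((finite_Iic _).image _)
    fun _ _ hst hT => h.iota_congr hst fun i hi => hT _ ⟨i, hi, rfl⟩

end RawExec.Shape

lemma finVar_fPi {A : TA ℕ} {N : ℝ} (D : Set ℝ) {m : ℕ} {Env : ℕ → RawExec ℕ}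
    (h : ∀ i, 1 ≤ i → i ≤ m → RawExec.Shape A N (Env i)) : FinVar D (fPi m Env) := by
  refine finVar_of_finite
    (T := ⋃ i ∈ Icc 1 m, (fun j => ((Env i).bnd j).time) '' Iic (Env i).n)
    ((finite_Icc 1 m).biUnion fun i _ => (finite_Iic _).image _) fun s t hst hT => ?_
  ext q
  refine and_congr_right fun h1 => and_congr_right fun h2 => ?_
  rw [(h q.1 h1 h2).iota_congr hst fun j hj => hT _ ?_]
  exact mem_biUnion (show q.1 ∈ Icc 1 m from ⟨h1, h2⟩) ⟨j, hj, rfl⟩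

lemma FlowOK.finite_events {A : TA ℕ} {N : ℝ} {w : ℝ → Set (MPred ℕ)} (hf : FlowOK A N w)
    (hw : FinVar (Ico 0 N) w) :
    {c : Cut | c.time ∈ Ico 0 N ∧ ∃ e ∈ A.edges, evm e c.side ∈ w c.time}.Finite := by
  refine (((hw 0 N).prod (finite_univ (α := Bool))).image (fun p => at' p.1 p.2)).subset ?_
  rintro c ⟨hc, e, he, hec⟩
  refine ⟨(c.time, c.side), ⟨⟨⟨hc, hc.1, hc.2.le⟩, ?_⟩, trivial⟩, rfl⟩
  rintro ⟨ε, hε, hcont⟩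
  obtain ⟨t, b, rfl⟩ := eq_at c
  simp only [time_at] at *
  cases b with
  | false =>
    obtain ⟨-, u, hu, hut, hiso⟩ := hf.minus t hc e he hec
    obtain ⟨r, hr1, hr2⟩ := exists_between (max_lt hut (sub_lt_self t hε))
    rw [max_lt_iff] at hr1
    have hrD : r ∈ Ico 0 N := ⟨hu.1.trans hr1.1.le, hr2.trans hc.2⟩
    refine (hiso r hrD hr1.1 hr2).2 false e he ?_
    rwa [hcont r hrD (by rw [abs_lt]; constructor <;> linarith)]
  | true =>
    obtain ⟨-, u, hu, hut, hiso⟩ := hf.plus t hc e he hec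
    obtain ⟨r, hr1, hr2⟩ := exists_between (lt_min hut (lt_add_of_pos_right t hε))
    rw [lt_min_iff] at hr2
    have hrD : r ∈ Ico 0 N := ⟨hc.1.trans hr1.le, hr2.1.trans hu.2⟩
    refine (hiso r hrD hr1 hr2.1).2 true e he ?_
    rwa [hcont r hrD (by rw [abs_lt]; constructor <;> linarith)]

end HyTime

namespace HyTime
open Cut Set

/-! ### Definability in monadic second-order logic -/

/-- The predicate `Q` of a parameter and a valuation is defined, over the time domain `D` and for
the parameters satisfying `G`, by a formula whose free variables are below `k`. -/
def Dfn {β σ : Type} (F : β → ℝ → Set σ) (G : β → Prop) (D : Set ℝ) (k : ℕ)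
    (Q : β → (ℕ → ℝ) → Prop) : Prop :=
  ∃ ψ : MSO σ, ψ.freeFO ⊆ Finset.range k ∧
    ∀ p v, G p → (∀ i, i < k → v i ∈ D) → (MSO.Sat D ψ (F p) v ↔ Q p v)

namespace Dfn
variable {β σ : Type} {F : β → ℝ → Set σ} {G : β → Prop} {D : Set ℝ} {k : ℕ}
  {Q Q' : β → (ℕ → ℝ) → Prop}

lemma congr (h : Dfn F G D k Q)
    (hQ : ∀ p v, G p → (∀ i, i < k → v i ∈ D) → (Q p v ↔ Q' p v)) : Dfn F G D k Q' := by
  obtain ⟨ψ, h1, h2⟩ := h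
  exact ⟨ψ, h1, fun p v hp hv => (h2 p v hp hv).trans (hQ p v hp hv)⟩

lemma mono {k' : ℕ} (h : Dfn F G D k Q) (hk : k ≤ k') : Dfn F G D k' Q := by
  obtain ⟨ψ, h1, h2⟩ := h
  exact ⟨ψ, h1.trans (Finset.range_subset_range.2 hk),
    fun p v hp hv => h2 p v hp fun i hi => hv i (hi.trans_le hk)⟩

lemma not (h : Dfn F G D k Q) : Dfn F G D k (fun p v => ¬ Q p v) := by
  obtain ⟨ψ, h1, h2⟩ := h
  exact ⟨.neg ψ, h1, fun p v hp hv => not_congr (h2 p v hp hv)⟩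

lemma or (h : Dfn F G D k Q) (h' : Dfn F G D k Q') : Dfn F G D k (fun p v => Q p v ∨ Q' p v) := by
  obtain ⟨ψ, h1, h2⟩ := h
  obtain ⟨ψ', h1', h2'⟩ := h'
  exact ⟨.disj ψ ψ', Finset.union_subset h1 h1',
    fun p v hp hv => or_congr (h2 p v hp hv) (h2' p v hp hv)⟩

lemma and (h : Dfn F G D k Q) (h' : Dfn F G D k Q') :
    Dfn F G D k (fun p v => Q p v ∧ Q' p v) :=
  (h.not.or h'.not).not.congr fun p v _ _ => by tauto

lemma imp (h : Dfn F G D k Q) (h' : Dfn F G D k Q') :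
    Dfn F G D k (fun p v => Q p v → Q' p v) :=
  (h.not.or h').congr fun p v _ _ => by tauto

lemma iff (h : Dfn F G D k Q) (h' : Dfn F G D k Q') :
    Dfn F G D k (fun p v => Q p v ↔ Q' p v) :=
  ((h.imp h').and (h'.imp h)).congr fun _ _ _ _ => iff_def.symm

lemma const (c : Prop) : Dfn F G D k (fun _ _ => c) := by
  by_cases hc : c
  · exact ⟨.neg (.exFO 0 (.lt 0 0)), by simp [MSO.freeFO], fun _ _ _ _ => by
      simp [MSO.Sat, hc]⟩
  · exact ⟨.exFO 0 (.lt 0 0), by simp [MSO.freeFO], fun _ _ _ _ => by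
      simp [MSO.Sat, hc]⟩

lemma exists_mem {P : β → (ℕ → ℝ) → ℝ → Prop} (h : Dfn F G D (k + 1) (fun p v => P p v (v k)))
    (hP : ∀ p v r r', P p (Function.update v k r') r ↔ P p v r) :
    Dfn F G D k (fun p v => ∃ r ∈ D, P p v r) := by
  obtain ⟨ψ, h1, h2⟩ := h
  refine ⟨.exFO k ψ, ?_, fun p v hp hv => ?_⟩
  · intro i hi
    obtain ⟨hi1, hi2⟩ := Finset.mem_erase.1 hi
    have := Finset.mem_range.1 (h1 hi2)
    exact Finset.mem_range.2 (by omega)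
  · refine exists_congr fun r => and_congr_right fun hr => ?_
    rw [h2 p _ hp]
    · simp only [Function.update_self, hP]
    · intro i hi
      rcases (Nat.lt_succ_iff.1 hi).lt_or_eq with hi | rfl
      · rw [Function.update_of_ne hi.ne]; exact hv i hi
      · rwa [Function.update_self]

lemma forall_mem {P : β → (ℕ → ℝ) → ℝ → Prop} (h : Dfn F G D (k + 1) (fun p v => P p v (v k)))
    (hP : ∀ p v r r', P p (Function.update v k r') r ↔ P p v r) :
    Dfn F G D k (fun p v => ∀ r ∈ D, P p v r) :=
  (h.not.exists_mem (P := fun p v r => ¬ P p v r)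
    fun p v r r' => not_congr (hP p v r r')).not.congr fun p v _ _ => by push Not; rfl

lemma exists_list {α : Type} (l : List α) {P : α → β → (ℕ → ℝ) → Prop}
    (h : ∀ a ∈ l, Dfn F G D k (P a)) : Dfn F G D k (fun p v => ∃ a ∈ l, P a p v) := by
  induction l with
  | nil => exact (const False).congr fun p v _ _ => by simp
  | cons a l ih =>
    exact ((h a (by simp)).or (ih fun b hb => h b (by simp [hb]))).congr
      fun p v _ _ => by simp

lemma forall_list {α : Type} (l : List α) {P : α → β → (ℕ → ℝ) → Prop}
    (h : ∀ a ∈ l, Dfn F G D k (P a)) : Dfn F G D k (fun p v => ∀ a ∈ l, P a p v) :=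
  (exists_list l fun a ha => (h a ha).not).not.congr fun p v _ _ => by push Not; rfl

lemma forall_option {α : Type} (o : Option α) {P : α → β → (ℕ → ℝ) → Prop}
    (h : ∀ a, Dfn F G D k (P a)) : Dfn F G D k (fun p v => ∀ a ∈ o, P a p v) := by
  cases o with
  | none => exact (const True).congr fun p v _ _ => by simp
  | some a => exact (h a).congr fun p v _ _ => by simp

lemma exists_bool {P : Bool → β → (ℕ → ℝ) → Prop} (h : ∀ b, Dfn F G D k (P b)) :
    Dfn F G D k (fun p v => ∃ b, P b p v) :=
  ((h false).or (h true)).congr fun p v _ _ => by rw [Bool.exists_bool]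

lemma forall_bool {P : Bool → β → (ℕ → ℝ) → Prop} (h : ∀ b, Dfn F G D k (P b)) :
    Dfn F G D k (fun p v => ∀ b, P b p v) :=
  ((h false).and (h true)).congr fun p v _ _ => by rw [Bool.forall_bool]

lemma app (P : σ) {x : ℕ} (hx : x < k) : Dfn F G D k (fun p v => P ∈ F p (v x)) :=
  ⟨.app P x, by simpa [MSO.freeFO] using hx, fun _ _ _ _ => Iff.rfl⟩

lemma lt {x y : ℕ} (hx : x < k) (hy : y < k) : Dfn F G D k (fun _ v => v x < v y) :=
  ⟨.lt x y, by simp [MSO.freeFO, Finset.insert_subset_iff, hx, hy], fun _ _ _ _ => Iff.rfl⟩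

lemma succ {x y : ℕ} (hx : x < k) (hy : y < k) : Dfn F G D k (fun _ v => v y = v x + 1) :=
  ⟨.succ x y, by simp [MSO.freeFO, Finset.insert_subset_iff, hx, hy], fun _ _ _ _ => Iff.rfl⟩

lemma le {x y : ℕ} (hx : x < k) (hy : y < k) : Dfn F G D k (fun _ v => v x ≤ v y) :=
  (lt hy hx).not.congr fun _ _ _ _ => not_lt

lemma eq {x y : ℕ} (hx : x < k) (hy : y < k) : Dfn F G D k (fun _ v => v x = v y) :=
  ((le hx hy).and (le hy hx)).congr fun _ _ _ _ => le_antisymm_iff.symm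

lemma cut_lt {x y : ℕ} (b c : Bool) (hx : x < k) (hy : y < k) :
    Dfn F G D k (fun _ v => at' (v x) b < at' (v y) c) :=
  ((lt hx hy).or ((eq hx hy).and (const (b = false ∧ c = true)))).congr
    fun _ _ _ _ => at_lt_at.symm

section bounded
variable {N : ℝ}

lemma add_lt {x y : ℕ} (c : ℕ) (hx : x < k) (hy : y < k) :
    Dfn F G (Ico 0 N) k (fun _ v => v x + c < v y) := by
  induction c generalizing x k with
  | zero => exact (lt hx hy).congr fun p v _ _ => by simp
  | succ c ih =>
    refine (exists_mem (k := k) (P := fun _ v r => r = v x + 1 ∧ r + c < v y)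
      ((succ (by omega) (by omega)).and (ih (x := k) (by omega) (by omega))) ?_).congr ?_
    · intro p v r r'
      rw [Function.update_of_ne hx.ne, Function.update_of_ne hy.ne]
    · intro p v _ hv
      have h1 := hv x hx
      have h2 := hv y hy
      rw [Nat.cast_succ]
      constructor
      · rintro ⟨r, -, rfl, h⟩
        linarith
      · intro h
        have : (0 : ℝ) ≤ c := c.cast_nonneg
        exact ⟨v x + 1, ⟨by linarith [h1.1], by linarith [h2.2]⟩, rfl, by linarith⟩

lemma add_le {x y : ℕ} (c : ℕ) (hx : x < k) (hy : y < k) :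
    Dfn F G (Ico 0 N) k (fun _ v => v x + c ≤ v y) := by
  induction c generalizing x k with
  | zero => exact (le hx hy).congr fun p v _ _ => by simp
  | succ c ih =>
    refine (exists_mem (k := k) (P := fun _ v r => r = v x + 1 ∧ r + c ≤ v y)
      ((succ (by omega) (by omega)).and (ih (x := k) (by omega) (by omega))) ?_).congr ?_
    · intro p v r r'
      rw [Function.update_of_ne hx.ne, Function.update_of_ne hy.ne]
    · intro p v _ hv
      have h1 := hv x hx
      have h2 := hv y hy
      rw [Nat.cast_succ]
      constructor
      · rintro ⟨r, -, rfl, h⟩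
        linarith
      · intro h
        have : (0 : ℝ) ≤ c := c.cast_nonneg
        exact ⟨v x + 1, ⟨by linarith [h1.1], by linarith [h2.2]⟩, rfl, by linarith⟩

lemma clkC_holds {x y : ℕ} (c : ClkC ℕ) (hx : x < k) (hy : y < k) :
    Dfn F G (Ico 0 N) k (fun _ v => c.holds natR (v y - v x)) := by
  induction c with
  | disj a b iha ihb => exact iha.or ihb
  | conj a b iha ihb => exact iha.and ihb
  | atom r c =>
    have h1 := add_lt (F := F) (G := G) (N := N) c hx hy
    have h2 := add_le (F := F) (G := G) (N := N) c hx hy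
    cases r with
    | lt =>
      refine h2.not.congr fun p v _ _ => ?_
      simp only [ClkC.holds, Cmp.denote, natR, not_le, sub_lt_iff_lt_add']
    | le =>
      refine h1.not.congr fun p v _ _ => ?_
      simp only [ClkC.holds, Cmp.denote, natR, not_lt, sub_le_iff_le_add']
    | eq =>
      refine (h2.and h1.not).congr fun p v _ _ => ?_
      simp only [ClkC.holds, Cmp.denote, natR, not_lt, sub_eq_iff_eq_add']
      exact ⟨fun h => le_antisymm h.2 h.1, fun h => ⟨h.ge, h.le⟩⟩
    | ge =>
      refine h2.congr fun p v _ _ => ?_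
      simp only [ClkC.holds, Cmp.denote, natR, le_sub_iff_add_le']
    | gt =>
      refine h1.congr fun p v _ _ => ?_
      simp only [ClkC.holds, Cmp.denote, natR, lt_sub_iff_add_lt']

lemma fIvl_mem {x y : ℕ} (I : FIvl ℕ) (hx : x < k) (hy : y < k) :
    Dfn F G (Ico 0 N) k (fun _ v => FIvl.Mem natR (v x) (v y) I) := by
  unfold FIvl.Mem
  refine and ?_ (forall_option I.hi fun c => ?_)
  · cases I.loC
    · exact (add_lt I.lo hx hy).congr fun p v _ _ => by simp [natR]
    · exact (add_le I.lo hx hy).congr fun p v _ _ => by simp [natR]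
  · cases I.hiC
    · exact (add_le c hx hy).not.congr fun p v _ _ => by simp [natR]
    · exact (add_lt c hx hy).not.congr fun p v _ _ => by simp [natR]

end bounded
end Dfn

/-! ### Second-order quantification over several predicates -/

/-- Existential quantification over all the predicates in a list. -/
def MSO.exSOs {σ : Type} (L : List σ) (φ : MSO σ) : MSO σ := L.foldr .exSO φ

lemma MSO.freeFO_exSOs {σ : Type} (L : List σ) (φ : MSO σ) :
    (MSO.exSOs L φ).freeFO = φ.freeFO := by
  induction L with
  | nil => rfl
  | cons P L ih => exact ih

lemma MSO.exists_of_sat_exSOs {σ : Type} {D : Set ℝ} {L : List σ} {φ : MSO σ} {f : ℝ → Set σ}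
    (hf : FinVar D f) {v : ℕ → ℝ} (h : MSO.Sat D (MSO.exSOs L φ) f v) :
    ∃ g : ℝ → Set σ, FinVar D g ∧ (∀ t ∈ D, ∀ Q, Q ∉ L → (Q ∈ g t ↔ Q ∈ f t)) ∧
      MSO.Sat D φ g v := by
  induction L generalizing f with
  | nil => exact ⟨f, hf, fun _ _ _ _ => Iff.rfl, h⟩
  | cons P L ih =>
    obtain ⟨h, hh, hhf, hs⟩ := h
    obtain ⟨g, hg, hgh, hs⟩ := ih hh hs
    refine ⟨g, hg, fun t ht Q hQ => ?_, hs⟩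
    rw [List.mem_cons, not_or] at hQ
    rw [hgh t ht Q hQ.2, hhf t ht Q hQ.1]

lemma MSO.sat_exSOs_of_sat {σ : Type} {D : Set ℝ} {L : List σ} {φ : MSO σ} {f g : ℝ → Set σ}
    (hf : FinVar D f) (hg : FinVar D g) (hgf : ∀ t Q, Q ∉ L → (Q ∈ g t ↔ Q ∈ f t)) {v : ℕ → ℝ}
    (h : MSO.Sat D φ g v) : MSO.Sat D (MSO.exSOs L φ) f v := by
  induction L generalizing f with
  | nil =>
    obtain rfl : g = f := by
      ext t Q
      exact hgf t Q (by simp)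
    exact h
  | cons P L ih =>
    have hmix := hg.map₂ hf fun a b => {Q | (Q = P ∧ Q ∈ a) ∨ (Q ≠ P ∧ Q ∈ b)}
    refine ⟨_, hmix, ?_, ih hmix fun t Q hQ => ?_⟩
    · intro t _ Q hQ
      simp [hQ]
    · by_cases hQP : Q = P
      · simp [hQP]
      · simp [hQP, hgf t Q (by simp [hQP, hQ])]

end HyTime

namespace HyTime
open Cut Set

/-- The flow of the `i`-th copy of the predicates. -/
def copyFlow (i : ℕ) (f : ℝ → Set (ℕ × MPred ℕ)) (t : ℝ) : Set (MPred ℕ) := {mp | (i, mp) ∈ f t}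

namespace Dfn
variable {β : Type} {F : β → ℝ → Set (ℕ × MPred ℕ)} {G : β → Prop} {N : ℝ} {k : ℕ}

lemma mem_copyFlow (i : ℕ) (mp : MPred ℕ) {x : ℕ} (hx : x < k) :
    Dfn F G (Ico 0 N) k (fun p v => mp ∈ copyFlow i (F p) (v x)) := app (i, mp) hx

lemma alive (A : TA ℕ) (i : ℕ) {x : ℕ} (hx : x < k) :
    Dfn F G (Ico 0 N) k (fun p v => Alive A (copyFlow i (F p)) (v x)) :=
  exists_list _ fun _ _ => mem_copyFlow i _ hx

lemma isReset (A : TA ℕ) (i c : ℕ) {x y : ℕ} (b : Bool) (hx : x < k) (hy : y < k) :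
    Dfn F G (Ico 0 N) k
      (fun p v => IsReset A N (copyFlow i (F p)) c (at' (v x) b) (v y)) := by
  refine or (forall_mem (P := fun p v u => ¬ u < v y) (lt (by omega) (by omega)).not ?_)
    (exists_bool fun b' => and (cut_lt _ _ hy hx) (exists_list _ fun e _ =>
      and (const _) (mem_copyFlow i _ hy)))
  intro p v r r'
  rw [Function.update_of_ne hy.ne]

lemma clkOK (A : TA ℕ) (i c : ℕ) {x : ℕ} (b : Bool) (κ : ClkC ℕ) (hx : x < k) :
    Dfn F G (Ico 0 N) k (fun p v => ClkOK A N (copyFlow i (F p)) c (at' (v x) b) κ) := by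
  refine forall_mem (imp (isReset A i c b (by omega) (by omega)) (imp (forall_mem
    (P := fun p v r => v k < r → ¬ IsReset A N (copyFlow i (F p)) c (at' (v x) b) r)
    (imp (lt (by omega) (by omega)) (isReset A i c b (by omega) (by omega)).not) ?_)
    (clkC_holds κ (by omega) (by omega)))) ?_
  · intro p v r r'
    rw [Function.update_of_ne (by omega), Function.update_of_ne (by omega)]
  · intro p v r r'
    rw [Function.update_of_ne hx.ne]

lemma flowOK (A : TA ℕ) (i : ℕ) :
    Dfn F G (Ico 0 N) 0 (fun p _ => FlowOK A N (copyFlow i (F p))) := by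
  suffices h : Dfn F G (Ico 0 N) 0 (fun p _ =>
      (∀ t ∈ Ico (0 : ℝ) N, ∀ v ∈ A.visited, ∀ v' ∈ A.visited,
        .st v ∈ copyFlow i (F p) t → .st v' ∈ copyFlow i (F p) t → v = v') ∧
      (∀ t ∈ Ico (0 : ℝ) N, ∀ b, ∀ e ∈ A.edges, ∀ e' ∈ A.edges,
        evm e b ∈ copyFlow i (F p) t → evm e' b ∈ copyFlow i (F p) t → e = e') ∧
      (∀ s ∈ Ico (0 : ℝ) N, ∀ t ∈ Ico (0 : ℝ) N, s < t →
        Alive A (copyFlow i (F p)) t → Alive A (copyFlow i (F p)) s) ∧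
      (∀ t ∈ Ico (0 : ℝ) N, (∀ u ∈ Ico (0 : ℝ) N, ¬ u < t) →
        ∃ v ∈ A.init, .st v ∈ copyFlow i (F p) t) ∧
      (∀ s ∈ Ico (0 : ℝ) N, ∀ t ∈ Ico (0 : ℝ) N, s < t → Alive A (copyFlow i (F p)) t →
        (∀ r ∈ Ico (0 : ℝ) N, ∀ b, at' s false < at' r b → at' r b < at' t true →
          ∀ e ∈ A.edges, evm e b ∉ copyFlow i (F p) r) →
        ∀ v ∈ A.visited, .st v ∈ copyFlow i (F p) s → .st v ∈ copyFlow i (F p) t) ∧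
      (∀ t ∈ Ico (0 : ℝ) N, ∀ e ∈ A.edges, evm e false ∈ copyFlow i (F p) t →
        .st e.2.1 ∈ copyFlow i (F p) t ∧ ∃ u ∈ Ico (0 : ℝ) N, u < t ∧
          ∀ r ∈ Ico (0 : ℝ) N, u < r → r < t → .st e.1 ∈ copyFlow i (F p) r ∧
            ∀ b, ∀ e' ∈ A.edges, evm e' b ∉ copyFlow i (F p) r) ∧
      (∀ t ∈ Ico (0 : ℝ) N, ∀ e ∈ A.edges, evm e true ∈ copyFlow i (F p) t →
        .st e.1 ∈ copyFlow i (F p) t ∧ ∃ u ∈ Ico (0 : ℝ) N, t < u ∧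
          ∀ r ∈ Ico (0 : ℝ) N, t < r → r < u → .st e.2.1 ∈ copyFlow i (F p) r ∧
            ∀ b, ∀ e' ∈ A.edges, evm e' b ∉ copyFlow i (F p) r) ∧
      (∃ u ∈ Ico (0 : ℝ) N, Alive A (copyFlow i (F p)) u ∧ ∀ r ∈ Ico (0 : ℝ) N, ¬ r < u →
        ∀ v ∈ A.visited, v ∉ A.final → .st v ∉ copyFlow i (F p) r) ∧
      (∀ t ∈ Ico (0 : ℝ) N, ∀ v ∈ A.visited, .st v ∈ copyFlow i (F p) t → ∀ x ∈ A.clocks,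
        ∀ c ∈ A.betaOf v x, ClkOK A N (copyFlow i (F p)) x (at' t true) c) ∧
      (∀ t ∈ Ico (0 : ℝ) N, ∀ b, ∀ e ∈ A.edges, evm e b ∈ copyFlow i (F p) t →
        ∀ q ∈ e.2.2.1, ClkOK A N (copyFlow i (F p)) q.1 (at' t b) q.2)) from
    h.congr fun p v _ _ => ⟨fun ⟨h1, h2, h3, h4, h5, h6, h7, h8, h9, h10⟩ =>
      ⟨h1, h2, h3, h4, h5, h6, h7, h8, h9, h10⟩, fun ⟨h1, h2, h3, h4, h5, h6, h7, h8, h9, h10⟩ =>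
      ⟨h1, h2, h3, h4, h5, h6, h7, h8, h9, h10⟩⟩
  repeat' first
    | exact mem_copyFlow i _ (by omega)
    | exact lt (by omega) (by omega)
    | exact cut_lt _ _ (by omega) (by omega)
    | exact alive A i (by omega)
    | exact clkOK A i _ _ _ (by omega)
    | exact const _
    | refine forall_mem ?_ ?_
    | refine exists_mem ?_ ?_
    | refine forall_list _ fun _ _ => ?_
    | refine exists_list _ fun _ _ => ?_
    | refine forall_bool fun _ => ?_
    | refine forall_option _ fun _ => ?_
    | refine not ?_
    | refine and ?_ ?_
    | refine imp ?_ ?_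
    | (intro p v r r'; simp [Function.update])

/-- The condition of being at the origin of time is definable. -/
lemma isZero (hN : 0 < N) {x : ℕ} (hx : x < k) : Dfn F G (Ico 0 N) k (fun _ v => v x = 0) := by
  refine (forall_mem (P := fun _ v u => ¬ u < v x) (lt (by omega) (by omega)).not ?_).congr ?_
  · intro p v r r'
    rw [Function.update_of_ne hx.ne]
  · intro p v _ hv
    exact ⟨fun h => le_antisymm (not_lt.1 (h 0 ⟨le_rfl, hN⟩)) (hv x hx).1,
      fun h u hu => h ▸ hu.1.not_gt⟩

lemma sameUpTo (A : TA ℕ) (i j : ℕ) {x : ℕ} (hx : x < k) :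
    Dfn F G (Ico 0 N) k (fun p v =>
      RawExec.Shape.SameUpTo A N (copyFlow i (F p)) (copyFlow j (F p)) (v x)) := by
  refine and (forall_mem (imp (lt (by omega) (by omega)).not (forall_list _ fun _ _ =>
      iff (mem_copyFlow i _ (by omega)) (mem_copyFlow j _ (by omega)))) ?_)
    (forall_mem (forall_bool fun _ => imp (cut_lt _ _ (by omega) (by omega))
      (forall_list _ fun _ _ =>
        iff (mem_copyFlow i _ (by omega)) (mem_copyFlow j _ (by omega)))) ?_)
  all_goals
    intro p v r r'
    rw [Function.update_of_ne hx.ne]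

end Dfn
end HyTime

namespace HyTime
open Cut Set

/-! ### Translating formulas -/

/-- Prefix condition on a newly quantified execution `ρ`. -/
def PrefixCond (Env : ℕ → RawExec ℕ) (t : ℝ) (d : Option ℕ) (ρ : RawExec ℕ) : Prop :=
  (d = none ∧ t = 0) ∨
    ∃ d₀, d = some d₀ ∧ RawExec.MemLen t (Env d₀) ∧ RawExec.EqUpTo ρ (Env d₀) t

/-- The path variables in `S` are interpreted by accepting executions bounded by `N`, and the copy
`κ π` of the predicates encodes the execution assigned to `π`. -/
def Encodes (A : TA ℕ) (N : ℝ) (S : Finset ℕ) (κ : ℕ → ℕ)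
    (p : (ℝ → Set (ℕ × MPred ℕ)) × (ℕ → RawExec ℕ)) : Prop :=
  FinVar (Ico 0 N) p.1 ∧ ∀ π ∈ S, RawExec.InSem natR A (some N) (p.2 π) ∧
    Agrees A N (copyFlow (κ π) p.1) (p.2 π)

/-- The predicates of the `i`-th copy that are used to encode executions of `A`. -/
def copyPreds (A : TA ℕ) (i : ℕ) : List (ℕ × MPred ℕ) :=
  A.visited.map (fun v => (i, .st v)) ++
    (A.edges.map (fun e => (i, evm e false)) ++ A.edges.map (fun e => (i, evm e true)))

variable {A : TA ℕ} {N : ℝ}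

lemma st_mem_copyPreds {i v : ℕ} (hv : v ∈ A.visited) : (i, MPred.st v) ∈ copyPreds A i := by
  simp only [copyPreds, List.mem_append, List.mem_map]
  exact Or.inl ⟨v, hv, rfl⟩

lemma evm_mem_copyPreds {i : ℕ} {e : IEdge ℕ} (he : e ∈ A.edges) (b : Bool) :
    (i, evm e b) ∈ copyPreds A i := by
  simp only [copyPreds, List.mem_append, List.mem_map]
  cases b
  · exact Or.inr (Or.inl ⟨e, he, rfl⟩)
  · exact Or.inr (Or.inr ⟨e, he, rfl⟩)

lemma fst_of_mem_copyPreds {i : ℕ} {q : ℕ × MPred ℕ} (h : q ∈ copyPreds A i) : q.1 = i := by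
  simp only [copyPreds, List.mem_append, List.mem_map] at h
  rcases h with ⟨_, _, rfl⟩ | ⟨_, _, rfl⟩ | ⟨_, _, rfl⟩ <;> rfl

lemma RawExec.inSem_iff {ρ : RawExec ℕ} : RawExec.InSem natR A (some N) ρ ↔
    RawExec.Shape A N ρ ∧ ρ.Clocks A ∧ ρ.state (ρ.n - 1) ∈ A.final := by
  rw [← RawExec.accExec_iff]
  simp [RawExec.InSem]

lemma Agrees.of_copy {f g : ℝ → Set (ℕ × MPred ℕ)} {i j : ℕ} {ρ : RawExec ℕ} (hij : i ≠ j)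
    (h : Agrees A N (copyFlow i f) ρ)
    (hgf : ∀ t ∈ Ico (0 : ℝ) N, ∀ Q, Q ∉ copyPreds A j → (Q ∈ g t ↔ Q ∈ f t)) :
    Agrees A N (copyFlow i g) ρ := by
  intro t ht
  have hiff : ∀ mp, mp ∈ copyFlow i g t ↔ mp ∈ copyFlow i f t := fun mp =>
    hgf t ht (i, mp) fun hc => hij (fst_of_mem_copyPreds hc)
  refine ⟨fun v hv => ?_, fun e he b => ?_⟩
  · rw [hiff]; exact (h t ht).1 v hv
  · rw [hiff]; exact (h t ht).2 e he b

lemma Agrees.eqUpTo_iff {w w' : ℝ → Set (MPred ℕ)} {ρ ρ' : RawExec ℕ} (h : RawExec.Shape A N ρ)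
    (h' : RawExec.Shape A N ρ') (hw : Agrees A N w ρ) (hw' : Agrees A N w' ρ') {t : ℝ}
    (ht : t ∈ Ico (0 : ℝ) N) :
    (Alive A w' t ∧ RawExec.Shape.SameUpTo A N w w' t) ↔
      (RawExec.MemLen t ρ' ∧ RawExec.EqUpTo ρ ρ' t) := by
  rw [h'.alive_iff hw' ht]
  refine and_congr_right fun hm => ?_
  rw [h.eqUpTo_iff h' hm]
  refine and_congr ?_ ?_
  · refine forall₃_congr fun s hs _ => forall₂_congr fun v hv => ?_
    rw [(hw s hs).1 v hv, (hw' s hs).1 v hv]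
  · refine forall₄_congr fun s hs b _ => forall₂_congr fun e he => ?_
    rw [(hw s hs).2 e he, (hw' s hs).2 e he]

/-- The prefix condition in terms of copies of the predicates. -/
def CopyPrefixCond (A : TA ℕ) (N : ℝ) (κ : ℕ → ℕ) (i : ℕ) (f : ℝ → Set (ℕ × MPred ℕ)) (t : ℝ) :
    Option ℕ → Prop
  | none => t = 0
  | some d => Alive A (copyFlow (κ d) f) t ∧
      RawExec.Shape.SameUpTo A N (copyFlow i f) (copyFlow (κ d) f) t

lemma CopyPrefixCond.dfn (hN : 0 < N) {β : Type} {F : β → ℝ → Set (ℕ × MPred ℕ)} {G : β → Prop}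
    {k x : ℕ} (κ : ℕ → ℕ) (i : ℕ) (hx : x < k) (d : Option ℕ) :
    Dfn F G (Ico 0 N) k (fun p v => CopyPrefixCond A N κ i (F p) (v x) d) := by
  cases d with
  | none => exact Dfn.isZero hN hx
  | some d => exact (Dfn.alive A _ hx).and (Dfn.sameUpTo A _ _ hx)

lemma copyPrefixCond_iff {κ : ℕ → ℕ} {i : ℕ} {f : ℝ → Set (ℕ × MPred ℕ)} {Env : ℕ → RawExec ℕ}
    {ρ : RawExec ℕ} {t : ℝ} (ht : t ∈ Ico 0 N) {d : Option ℕ} (hρ : RawExec.Shape A N ρ)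
    (hw : Agrees A N (copyFlow i f) ρ) (hd : ∀ π, d = some π →
      RawExec.Shape A N (Env π) ∧ Agrees A N (copyFlow (κ π) f) (Env π)) :
    CopyPrefixCond A N κ i f t d ↔ PrefixCond Env t d ρ := by
  cases d with
  | none => simp [CopyPrefixCond, PrefixCond]
  | some d =>
    obtain ⟨h1, h2⟩ := hd d rfl
    simpa [CopyPrefixCond, PrefixCond] using Agrees.eqUpTo_iff hρ h1 hw h2 ht

/-- Definable predicates are closed under quantification over executions. -/
lemma Dfn.exists_exec (hN : 0 < N) {S : Finset ℕ} {κ : ℕ → ℕ} {i k x π : ℕ} {d : Option ℕ}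
    (hκ : ∀ π ∈ S, κ π < i) (hd : ∀ π, d = some π → π ∈ S) (hx : x < k)
    {Q : (ℕ → RawExec ℕ) → ℝ → Prop}
    (hQ : Dfn Prod.fst (Encodes A N (insert π S) (Function.update κ π i)) (Ico 0 N) k
      (fun p v => Q p.2 (v x))) :
    Dfn Prod.fst (Encodes A N S κ) (Ico 0 N) k (fun p v => ∃ ρ,
      RawExec.InSem natR A (some N) ρ ∧ PrefixCond p.2 (v x) d ρ ∧
        Q (Function.update p.2 π ρ) (v x)) := by
  classical
  obtain ⟨ψ₁, hψ₁, h₁⟩ := hQ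
  obtain ⟨ψ₂, hψ₂, h₂⟩ := (((Dfn.flowOK A i).mono (Nat.zero_le k)).and
    (CopyPrefixCond.dfn hN κ i hx d) :
    Dfn (fun f => f) (fun _ => True) (Ico 0 N) k (fun f v => FlowOK A N (copyFlow i f) ∧
      CopyPrefixCond A N κ i f (v x) d))
  have hgood : ∀ f g Env ρ, Encodes A N S κ (f, Env) → FinVar (Ico 0 N) g →
      (∀ t ∈ Ico (0 : ℝ) N, ∀ Q, Q ∉ copyPreds A i → (Q ∈ g t ↔ Q ∈ f t)) →
      RawExec.InSem natR A (some N) ρ → Agrees A N (copyFlow i g) ρ →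
      Encodes A N (insert π S) (Function.update κ π i) (g, Function.update Env π ρ) := by
    intro f g Env ρ hf hg hgf hρ hw
    refine ⟨hg, fun π' hπ' => ?_⟩
    by_cases h : π' = π
    · subst h
      simpa using ⟨hρ, hw⟩
    · have hS : π' ∈ S := (Finset.mem_insert.1 hπ').resolve_left h
      simp only [Function.update_of_ne h]
      exact ⟨(hf.2 π' hS).1, (hf.2 π' hS).2.of_copy (hκ π' hS).ne hgf⟩
  have hpre : ∀ f g Env, Encodes A N S κ (f, Env) →
      (∀ t ∈ Ico (0 : ℝ) N, ∀ Q, Q ∉ copyPreds A i → (Q ∈ g t ↔ Q ∈ f t)) →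
      ∀ π, d = some π → RawExec.Shape A N (Env π) ∧ Agrees A N (copyFlow (κ π) g) (Env π) := by
    intro f g Env hf hgf π hπ
    have := hf.2 π (hd π hπ)
    exact ⟨(RawExec.inSem_iff.1 this.1).1, this.2.of_copy (hκ π (hd π hπ)).ne hgf⟩
  refine ⟨MSO.exSOs (copyPreds A i) (.neg (.disj (.neg ψ₂) (.neg ψ₁))), ?_, ?_⟩
  · rw [MSO.freeFO_exSOs]
    exact Finset.union_subset hψ₂ hψ₁
  · rintro ⟨f, Env⟩ v hf hv
    have hand : ∀ g, MSO.Sat (Ico 0 N) (.neg (.disj (.neg ψ₂) (.neg ψ₁))) g v ↔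
        MSO.Sat (Ico 0 N) ψ₂ g v ∧ MSO.Sat (Ico 0 N) ψ₁ g v := by
      intro g
      simp only [MSO.Sat]
      tauto
    constructor
    · intro hs
      obtain ⟨g, hg, hgf, hs⟩ := MSO.exists_of_sat_exSOs hf.1 hs
      rw [hand, h₂ g v trivial hv] at hs
      obtain ⟨⟨hok, hp⟩, hs⟩ := hs
      have hgi : FinVar (Ico 0 N) (copyFlow i g) := hg.map fun a => {mp | (i, mp) ∈ a}
      obtain ⟨ρ, hρ, hw⟩ := hok.exists_exec hN (hok.finite_events hgi)
      have hsem : RawExec.InSem natR A (some N) ρ :=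
        RawExec.inSem_iff.2 ⟨hρ, hρ.clocks_and_final hw hok⟩
      exact ⟨ρ, hsem, (copyPrefixCond_iff (hv x hx) hρ hw (hpre f g Env hf hgf)).1 hp,
        (h₁ (g, _) v (hgood f g Env ρ hf hg hgf hsem hw) hv).1 hs⟩
    · rintro ⟨ρ, hsem, hp, hq⟩
      obtain ⟨hρ, hc, hfin⟩ := RawExec.inSem_iff.1 hsem
      have hmix := hf.1.map₂ (hρ.finVar_iota (Ico 0 N))
        fun a b => {Q | (Q ∉ copyPreds A i ∧ Q ∈ a) ∨ (Q ∈ copyPreds A i ∧ Q.2 ∈ b)}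
      set g : ℝ → Set (ℕ × MPred ℕ) := fun t =>
        {Q | (Q ∉ copyPreds A i ∧ Q ∈ f t) ∨ (Q ∈ copyPreds A i ∧ Q.2 ∈ iota ρ t)} with hgdef
      have hgf : ∀ t Q, Q ∉ copyPreds A i → (Q ∈ g t ↔ Q ∈ f t) := by
        intro t Q hQ
        simp [hgdef, hQ]
      have hw : Agrees A N (copyFlow i g) ρ := by
        have hiff : ∀ t mp, (i, mp) ∈ copyPreds A i →
            (mp ∈ copyFlow i g t ↔ mp ∈ iota ρ t) := by
          intro t mp hmp
          simp [hgdef, hmp, copyFlow]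
        exact fun t _ => ⟨fun v hv => hiff t _ (st_mem_copyPreds hv),
          fun e he b => hiff t _ (evm_mem_copyPreds he b)⟩
      refine MSO.sat_exSOs_of_sat hf.1 hmix hgf ((hand g).2 ⟨(h₂ g v trivial hv).2 ⟨?_, ?_⟩, ?_⟩)
      · exact hρ.flowOK hw hc hfin
      · exact (copyPrefixCond_iff (hv x hx) hρ hw
          (hpre f g Env hf fun t _ => hgf t)).2 hp
      · exact (h₁ (g, _) v (hgood f g Env ρ hf hmix (fun t _ => hgf t) hsem hw) hv).2 hq

lemma Dfn.label {S : Finset ℕ} {κ : ℕ → ℕ} {k x π : ℕ} (hπ : π ∈ S) (hx : x < k)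
    (L : ℕ → Prop) :
    Dfn Prod.fst (Encodes A N S κ) (Ico 0 N) k (fun p v => RawExec.MemLen (v x) (p.2 π) ∧
      ∃ s, RawExec.StateAt (p.2 π) (v x) s ∧ L s) := by
  refine (Dfn.exists_list A.visited fun s _ =>
    (Dfn.mem_copyFlow (κ π) (.st s) hx).and (Dfn.const (L s))).congr ?_
  intro p v hp hv
  obtain ⟨hsem, hw⟩ := hp.2 π hπ
  have hρ := (RawExec.inSem_iff.1 hsem).1
  constructor
  · rintro ⟨s, hs, hms, hl⟩
    obtain ⟨j, hj, hm, rfl⟩ := (RawExec.Shape.st_mem_iff hw (hv x hx) hs).1 hms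
    exact ⟨⟨j, hj, hm⟩, _, ⟨j, hj, hm, rfl⟩, hl⟩
  · rintro ⟨-, s, ⟨j, hj, hm, rfl⟩, hl⟩
    exact ⟨_, hρ.state_visited hj, hρ.st_of_mem hw hj hm, hl⟩

lemma Dfn.hSat (hN : 0 < N) (φ : HF ℕ) : ∀ {S : Finset ℕ} {κ : ℕ → ℕ} {i k x : ℕ} {d : Option ℕ},
    φ.free ⊆ S → (∀ π ∈ S, κ π < i) → (∀ π, d = some π → π ∈ S) → x < k →
    Dfn Prod.fst (Encodes A N S κ) (Ico 0 N) k
      (fun p v => HSat natR A (some N) φ p.2 (v x) d) := by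
  induction φ with
  | pos q π => exact fun hS _ _ hx => Dfn.label (hS (Finset.mem_singleton_self π)) hx _
  | neg q π => exact fun hS _ _ hx => Dfn.label (hS (Finset.mem_singleton_self π)) hx _
  | disj a b iha ihb =>
    intro S κ i k x d hS hκ hd hx
    exact (iha (Finset.union_subset_left hS) hκ hd hx).or
      (ihb (Finset.union_subset_right hS) hκ hd hx)
  | conj a b iha ihb =>
    intro S κ i k x d hS hκ hd hx
    exact (iha (Finset.union_subset_left hS) hκ hd hx).and
      (ihb (Finset.union_subset_right hS) hκ hd hx)
  | fut I a iha =>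
    intro S κ i k x d hS hκ hd hx
    refine (Dfn.exists_mem (P := fun p v r => v x < r ∧ FIvl.Mem natR (v x) r I ∧
      HSat natR A (some N) a p.2 r d) ((Dfn.lt (by omega) (by omega)).and
        ((Dfn.fIvl_mem I (by omega) (by omega)).and (iha hS hκ hd (by omega)))) ?_).congr ?_
    · intro p v r r'
      rw [Function.update_of_ne hx.ne]
    · intro p v _ hv
      constructor
      · rintro ⟨r, hr, h1, h2, h3⟩
        exact ⟨r, h1, hr.2, h2, h3⟩
      · rintro ⟨r, h1, hr, h2, h3⟩
        exact ⟨r, ⟨(hv x hx).1.trans h1.le, hr⟩, h1, h2, h3⟩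
  | glob I a iha =>
    intro S κ i k x d hS hκ hd hx
    refine (Dfn.forall_mem (P := fun p v r => v x < r → FIvl.Mem natR (v x) r I →
      HSat natR A (some N) a p.2 r d) ((Dfn.lt (by omega) (by omega)).imp
        ((Dfn.fIvl_mem I (by omega) (by omega)).imp (iha hS hκ hd (by omega)))) ?_).congr ?_
    · intro p v r r'
      rw [Function.update_of_ne hx.ne]
    · intro p v _ hv
      exact ⟨fun h r h1 hr h2 => h r ⟨(hv x hx).1.trans h1.le, hr⟩ h1 h2,
        fun h r hr h1 h2 => h r h1 hr.2 h2⟩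
  | untl I a b iha ihb =>
    intro S κ i k x d hS hκ hd hx
    refine (Dfn.exists_mem (P := fun p v r => v x < r ∧ FIvl.Mem natR (v x) r I ∧
      HSat natR A (some N) b p.2 r d ∧ ∀ s ∈ Ico (0 : ℝ) N, v x < s → s < r →
        HSat natR A (some N) a p.2 s d) ((Dfn.lt (by omega) (by omega)).and
        ((Dfn.fIvl_mem I (by omega) (by omega)).and
          ((ihb (Finset.union_subset_right hS) hκ hd (by omega)).and
            (Dfn.forall_mem (P := fun p v s => v x < s → s < v k →
                HSat natR A (some N) a p.2 s d)
              ((Dfn.lt (by omega) (by omega)).imp ((Dfn.lt (by omega) (by omega)).imp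
                (iha (Finset.union_subset_left hS) hκ hd (by omega)))) ?_)))) ?_).congr ?_
    · intro p v r r'
      rw [Function.update_of_ne (by omega), Function.update_of_ne (by omega)]
    · intro p v r r'
      rw [Function.update_of_ne hx.ne]
    · intro p v _ hv
      have h0 := (hv x hx).1
      constructor
      · rintro ⟨r, hr, h1, h2, h3, h4⟩
        exact ⟨r, h1, hr.2, h2, h3, fun s hs hs' =>
          h4 s ⟨h0.trans hs.le, hs'.trans hr.2⟩ hs hs'⟩
      · rintro ⟨r, h1, hr, h2, h3, h4⟩
        exact ⟨r, ⟨h0.trans h1.le, hr⟩, h1, h2, h3, fun s _ => h4 s⟩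
  | ex π a iha =>
    intro S κ i k x d hS hκ hd hx
    refine Dfn.exists_exec hN (π := π) (Q := fun Env t => HSat natR A (some N) a Env t (some π))
      hκ hd hx (iha (i := i + 1) ?_ ?_ ?_ hx)
    · intro j hj
      by_cases h : j = π
      · simp [h]
      · exact Finset.mem_insert_of_mem (hS (Finset.mem_erase.2 ⟨h, hj⟩))
    · intro j hj
      by_cases h : j = π
      · simp [h]
      · rw [Function.update_of_ne h]
        exact (hκ j ((Finset.mem_insert.1 hj).resolve_left h)).trans (Nat.lt_succ_self i)
    · rintro j ⟨⟩
      exact Finset.mem_insert_self _ _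
  | all π a iha =>
    intro S κ i k x d hS hκ hd hx
    refine (Dfn.exists_exec hN (π := π) (Q := fun Env t => ¬ HSat natR A (some N) a Env t (some π))
      hκ hd hx (iha (i := i + 1) ?_ ?_ ?_ hx).not).not.congr ?_
    · intro j hj
      by_cases h : j = π
      · simp [h]
      · exact Finset.mem_insert_of_mem (hS (Finset.mem_erase.2 ⟨h, hj⟩))
    · intro j hj
      by_cases h : j = π
      · simp [h]
      · rw [Function.update_of_ne h]
        exact (hκ j ((Finset.mem_insert.1 hj).resolve_left h)).trans (Nat.lt_succ_self i)
    · rintro j ⟨⟩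
      exact Finset.mem_insert_self _ _
    · intro p v _ _
      push Not
      rfl

end HyTime

namespace HyTime

/-- Fix `N > 0`, a timed automaton `A`, and an HCMTL* formula `φ` whose
free path variables are among `π_1, …, π_m` (represented by `1, …, m`). There are `m+1`
MSO(<,+1) formulas `⟨φ⟩_0(x), …, ⟨φ⟩_m(x)` over the disjoint indexed copies
`MP_1 ∪ ⋯ ∪ MP_m` of `V ∪ T ∪ R`, each with the single free first-order variable `x`
(variable `0`), such that for every path environment `Π` into `Exec_N(A)` and every
`t ∈ [0,N)`: (1) for each `i ∈ {1,…,m}`, `Π, t, π_i ⊨^N_A φ` iff `f_Π ⊨ ⟨φ⟩_i(t)`, and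
(2) `Π, 0, ε ⊨^N_A φ` iff `f_Π ⊨ ⟨φ⟩_0(0)`. -/
theorem hcmtl_to_MSO (N : ℝ) (hN : 0 < N) (A : TA ℕ) (m : ℕ) (φ : HF ℕ)
    (hfree : φ.free ⊆ Finset.Icc 1 m) :
    ∃ tr : ℕ → MSO (ℕ × MPred ℕ),
      (∀ i, i ≤ m → (tr i).freeFO ⊆ {0}) ∧
      ∀ Env : ℕ → RawExec ℕ,
        (∀ i, 1 ≤ i → i ≤ m → (Env i).IsAccExec natR A ∧ (Env i).BoundedBy N) →
        (∀ t ∈ Set.Ico (0 : ℝ) N, ∀ i, 1 ≤ i → i ≤ m →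
          (HSat natR A (some N) φ Env t (some i) ↔
            MSO.Sat (Set.Ico 0 N) (tr i) (fPi m Env) (fun _ => t))) ∧
        (HSat natR A (some N) φ Env 0 none ↔
          MSO.Sat (Set.Ico 0 N) (tr 0) (fPi m Env) (fun _ => 0)) := by
  have key : ∀ d : Option ℕ, (∀ i, d = some i → i ∈ Finset.Icc 1 m) →
      Dfn Prod.fst (Encodes A N (Finset.Icc 1 m) id) (Set.Ico 0 N) 1
        (fun p v => HSat natR A (some N) φ p.2 (v 0) d) := fun d hd =>
    Dfn.hSat hN φ (i := m + 1) hfree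
      (fun π hπ => Nat.lt_succ_of_le (Finset.mem_Icc.1 hπ).2) hd Nat.zero_lt_one
  have henc : ∀ Env : ℕ → RawExec ℕ,
      (∀ i, 1 ≤ i → i ≤ m → (Env i).IsAccExec natR A ∧ (Env i).BoundedBy N) →
      Encodes A N (Finset.Icc 1 m) id (fPi m Env, Env) := by
    intro Env hE
    refine ⟨finVar_fPi (A := A) (N := N) _ fun i h1 h2 =>
      ((RawExec.accExec_iff A N _).1 (hE i h1 h2)).1, fun π hπ => ?_⟩
    obtain ⟨h1, h2⟩ := Finset.mem_Icc.1 hπ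
    refine ⟨RawExec.inSem_iff.2 ((RawExec.accExec_iff A N _).1 (hE π h1 h2)), fun t _ => ?_⟩
    have hiff : ∀ mp, mp ∈ copyFlow (id π) (fPi m Env) t ↔ mp ∈ iota (Env π) t := fun mp =>
      ⟨fun h => h.2.2, fun h => ⟨h1, h2, h⟩⟩
    exact ⟨fun v _ => hiff _, fun e _ b => hiff _⟩
  have hcase : ∀ i, ∃ ψ : MSO (ℕ × MPred ℕ), i ≤ m → ψ.freeFO ⊆ {0} ∧
      ∀ p v, Encodes A N (Finset.Icc 1 m) id p → (∀ j, j < 1 → v j ∈ Set.Ico 0 N) →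
        (MSO.Sat (Set.Ico 0 N) ψ p.1 v ↔
          HSat natR A (some N) φ p.2 (v 0) (if i = 0 then none else some i)) := by
    intro i
    by_cases hi : i ≤ m
    · obtain ⟨ψ, h1, h2⟩ := key (if i = 0 then none else some i) (by
        intro j hj
        split_ifs at hj with h0
        obtain rfl : i = j := by simpa using hj
        exact Finset.mem_Icc.2 ⟨Nat.one_le_iff_ne_zero.2 h0, hi⟩)
      exact ⟨ψ, fun _ => ⟨h1, h2⟩⟩
    · exact ⟨.lt 0 0, fun h => absurd h hi⟩
  choose tr htr using hcase
  refine ⟨tr, fun i hi => (htr i hi).1, fun Env hE => ⟨fun t ht i h1 h2 => ?_, ?_⟩⟩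
  · have := (htr i h2).2 _ (fun _ => t) (henc Env hE) fun _ _ => ht
    rw [if_neg (Nat.one_le_iff_ne_zero.1 h1)] at this
    exact this.symm
  · have := (htr 0 (Nat.zero_le m)).2 _ (fun _ => 0) (henc Env hE) fun _ _ => ⟨le_rfl, hN⟩
    rw [if_pos rfl] at this
    exact this.symm

end HyTime
end
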